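/- For every singular cardinal λ with cf(λ) = ω, there exists a function rts : [λ⁺]² → [λ⁺]² such that for all cofinal subsets A, B of λ⁺ and every cardinal θ < λ, there exists a stationary subset S* ⊆ E^{λ⁺}_{>θ} with rts[A ⊛ B] ⊇ [S*]². -/

import Mathlib

open Ordinal Cardinal Set

/-- `C` is closed in the ordinal `o`: every limit point of `C` below `o` belongs to `C`. -/
def IsClosedIn (C : Set Ordinal) (o : Ordinal) : Prop :=
  ∀ p, p < o → p ≠ 0 → (∀ q < p, ∃ r ∈ C, q < r ∧ r < p) → p ∈ C

/-- `C` is a club (closed unbounded) subset of the ordinal `o`. -/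
def IsClubIn (C : Set Ordinal) (o : Ordinal) : Prop :=
  C ⊆ Set.Iio o ∧ IsClosedIn C o ∧ ∀ p < o, ∃ q ∈ C, p ≤ q

/-- `S` is stationary in the ordinal `o`: it meets every club subset of `o`. -/
def IsStationaryIn (S : Set Ordinal) (o : Ordinal) : Prop :=
  S ⊆ Set.Iio o ∧ ∀ C, IsClubIn C o → (S ∩ C).Nonempty

/-- `A` is a cofinal (unbounded) subset of the ordinal `o`. -/
def IsCofinalIn (A : Set Ordinal) (o : Ordinal) : Prop :=
  A ⊆ Set.Iio o ∧ ∀ p < o, ∃ q ∈ A, p ≤ q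

/-- A cardinal is singular if it is infinite and its cofinality is smaller than itself. -/
def IsSingular (c : Cardinal) : Prop :=
  Cardinal.aleph0 ≤ c ∧ c.ord.cof < c


universe u v w

/-- `X` is covered by a family indexed by a type of cardinality at most `c`. -/
def SizeLE {α : Type v} (X : Set α) (c : Cardinal.{u}) : Prop :=
  ∃ (ι : Type u) (f : ι → α), #ι ≤ c ∧ X ⊆ range f

namespace SizeLE

variable {α : Type v} {β : Type w} {X Y : Set α} {c d : Cardinal.{u}}

theorem mono (h : SizeLE Y c) (hXY : X ⊆ Y) : SizeLE X c := by
  obtain ⟨ι, f, hι, hf⟩ := h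
  exact ⟨ι, f, hι, hXY.trans hf⟩

theorem mono_card (h : SizeLE X c) (hcd : c ≤ d) : SizeLE X d := by
  obtain ⟨ι, f, hι, hf⟩ := h
  exact ⟨ι, f, hι.trans hcd, hf⟩

theorem image (h : SizeLE X c) (g : α → β) : SizeLE (g '' X) c := by
  obtain ⟨ι, f, hι, hf⟩ := h
  refine ⟨ι, g ∘ f, hι, ?_⟩
  rintro _ ⟨x, hx, rfl⟩
  obtain ⟨i, rfl⟩ := hf hx
  exact ⟨i, rfl⟩

theorem empty : SizeLE (∅ : Set α) c :=
  ⟨PEmpty, PEmpty.elim, by simp, empty_subset _⟩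

theorem of_injOn {Z : Set β} (h : SizeLE Z c) (g : α → β) (hg : InjOn g X)
    (hm : MapsTo g X Z) : SizeLE X c := by
  rcases X.eq_empty_or_nonempty with rfl | ⟨x₀, hx₀⟩
  · exact empty
  have : Nonempty α := ⟨x₀⟩
  refine (h.image (Function.invFunOn g X)).mono fun x hx => ?_
  exact ⟨g x, hm hx, hg.leftInvOn_invFunOn hx⟩

theorem of_countable (h : X.Countable) (hc : ℵ₀ ≤ c) : SizeLE X c := by
  rcases X.eq_empty_or_nonempty with rfl | hX
  · exact empty
  obtain ⟨f, rfl⟩ := h.exists_eq_range hX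
  exact ⟨ULift ℕ, fun n => f n.down, by simpa using hc, fun x ⟨n, hn⟩ => ⟨⟨n⟩, hn⟩⟩

theorem countable (h : SizeLE X ℵ₀) : X.Countable := by
  obtain ⟨ι, f, hι, hf⟩ := h
  have : Countable ι := mk_le_aleph0_iff.1 hι
  exact (countable_range f).mono hf

theorem biUnion {F : α → Set β} (hc : ℵ₀ ≤ c) (hX : SizeLE X c)
    (hF : ∀ x ∈ X, SizeLE (F x) c) : SizeLE (⋃ x ∈ X, F x) c := by
  obtain ⟨ι, f, hι, hf⟩ := hX
  have h1 : ∀ i : {i : ι // f i ∈ X}, SizeLE (F (f i)) c := fun i => hF _ i.2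
  choose κ g hκ hg using h1
  refine ⟨Σ i, κ i, fun p => g p.1 p.2, ?_, ?_⟩
  · rw [mk_sigma]
    calc Cardinal.sum (fun i => #(κ i)) ≤ Cardinal.sum (fun _ : {i : ι // f i ∈ X} => c) :=
          Cardinal.sum_le_sum _ _ hκ
      _ = #{i : ι // f i ∈ X} * c := by simp
      _ ≤ c * c := by gcongr; exact (mk_subtype_le _).trans hι
      _ = c := mul_eq_self hc
  · intro y hy
    simp only [mem_iUnion] at hy
    obtain ⟨x, hx, hy⟩ := hy
    obtain ⟨i, rfl⟩ := hf hx
    obtain ⟨j, hj⟩ := hg ⟨i, hx⟩ hy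
    exact ⟨⟨⟨i, hx⟩, j⟩, hj⟩

theorem iUnion_nat {F : ℕ → Set β} (hc : ℵ₀ ≤ c) (hF : ∀ n, SizeLE (F n) c) :
    SizeLE (⋃ n, F n) c := by
  have := biUnion (X := (univ : Set ℕ)) (F := F) hc (of_countable (to_countable _) hc)
    (fun n _ => hF n)
  simpa using this

theorem union (hc : ℵ₀ ≤ c) (h : SizeLE X c) (h' : SizeLE Y c) : SizeLE (X ∪ Y) c := by
  refine (iUnion_nat (F := fun n => if n = 0 then X else Y) hc ?_).mono ?_
  · intro n
    split_ifs <;> assumption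
  · rintro x (hx | hx)
    · exact mem_iUnion.2 ⟨0, by simpa using hx⟩
    · exact mem_iUnion.2 ⟨1, by simpa using hx⟩

theorem Iio_ordinal (o : Ordinal.{u}) : SizeLE (Iio o) o.card :=
  ⟨o.ToType, fun i => Ordinal.ToType.mk.symm i, by simp,
    fun x hx => ⟨Ordinal.ToType.mk ⟨x, hx⟩, by simp⟩⟩

/-- Families of size less than the cofinality of `o` are bounded below `o`. -/
theorem exists_bound {o : Ordinal.{u}} (h : SizeLE X c) (hc : c < o.cof) (z : α → Ordinal.{u})
    (hz : ∀ x ∈ X, z x < o) : ∃ b < o, ∀ x ∈ X, z x < b := by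
  obtain ⟨ι, f, hι, hf⟩ := h
  refine ⟨⨆ i : {i : ι // f i ∈ X}, z (f i) + 1, ?_, ?_⟩
  · exact iSup_add_one_lt_of_lt_cof (((mk_subtype_le _).trans hι).trans_lt hc)
      (fun i => hz _ i.2)
  · intro x hx
    obtain ⟨i, rfl⟩ := hf hx
    exact Ordinal.lt_iSup_add_one (f := fun i : {i : ι // f i ∈ X} => z (f i)) ⟨i, hx⟩

theorem exists_fiber {o : Ordinal.{u}} {X : Set Ordinal.{u}} {T : Set α} (h : SizeLE T c)
    (hc : c < o.cof) (hX : ∀ p < o, ∃ q ∈ X, q < o ∧ p ≤ q) (g : Ordinal.{u} → α)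
    (hg : ∀ x ∈ X, x < o → g x ∈ T) :
    ∃ t ∈ T, ∀ p < o, ∃ q ∈ X, q < o ∧ p ≤ q ∧ g q = t := by
  by_contra! H
  have : ∀ t : α, ∃ z, t ∈ T → z < o ∧ ∀ q ∈ X, q < o → z ≤ q → g q ≠ t := by
    intro t
    by_cases ht : t ∈ T
    · obtain ⟨p, hp, hp'⟩ := H t ht
      exact ⟨p, fun _ => ⟨hp, hp'⟩⟩
    · exact ⟨0, fun h => absurd h ht⟩
  choose z hz using this
  obtain ⟨b, hb, hb'⟩ := h.exists_bound hc z (fun t ht => (hz t ht).1)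
  obtain ⟨q, hq, hqo, hbq⟩ := hX b hb
  have := hg q hq hqo
  exact (hz _ this).2 q hq hqo ((hb' _ this).le.trans hbq) rfl

end SizeLE

theorem exists_unbounded_sizeLE_cof (o : Ordinal.{u}) :
    ∃ X ⊆ Iio o, (∀ p < o, ∃ q ∈ X, p ≤ q) ∧ SizeLE X o.cof := by
  obtain ⟨s, hs, hs'⟩ := Order.exists_cof_eq o.ToType
  refine ⟨range fun i : s => (Ordinal.ToType.mk.symm i.1 : Ordinal), ?_, ?_, s, _, ?_, subset_rfl⟩
  · rintro _ ⟨i, rfl⟩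
    exact (Ordinal.ToType.mk.symm i.1).2
  · intro p hp
    obtain ⟨i, hi, hpi⟩ := hs (Ordinal.ToType.mk ⟨p, hp⟩)
    refine ⟨_, ⟨⟨i, hi⟩, rfl⟩, ?_⟩
    have := Ordinal.ToType.mk.symm.monotone hpi
    simpa using Subtype.coe_le_coe.2 this
  · rw [hs', cof_toType]


/-- The least element of `E` that is at least `p`. -/
noncomputable def nextIn (E : Set Ordinal.{u}) (p : Ordinal.{u}) : Ordinal.{u} :=
  sInf {x | x ∈ E ∧ p ≤ x}

/-- The least strict upper bound of `X`. -/
noncomputable def strictSup (X : Set Ordinal.{u}) : Ordinal.{u} :=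
  sInf {z | ∀ x ∈ X, x < z}

/-- The supremum of the elements of `E` that are at most `γ`. -/
noncomputable def lastIn (E : Set Ordinal.{u}) (γ : Ordinal.{u}) : Ordinal.{u} :=
  sSup {x | x ∈ E ∧ x ≤ γ}

section Basic

variable {E F X : Set Ordinal.{u}} {o p q x z γ : Ordinal.{u}}

theorem nextIn_spec (h : ∃ x ∈ E, p ≤ x) : nextIn E p ∈ E ∧ p ≤ nextIn E p := by
  obtain ⟨x, hx, hpx⟩ := h
  exact csInf_mem (s := {x | x ∈ E ∧ p ≤ x}) ⟨x, hx, hpx⟩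

theorem nextIn_le (hx : x ∈ E) (h : p ≤ x) : nextIn E p ≤ x :=
  csInf_le' (s := {x | x ∈ E ∧ p ≤ x}) ⟨hx, h⟩

theorem strictSup_le (h : ∀ x ∈ X, x < z) : strictSup X ≤ z :=
  csInf_le' (s := {z | ∀ x ∈ X, x < z}) h

theorem lt_strictSup (h : ∀ x ∈ X, x < z) (hx : x ∈ X) : x < strictSup X :=
  csInf_mem (s := {z | ∀ x ∈ X, x < z}) ⟨z, h⟩ x hx

theorem lastIn_le : lastIn E γ ≤ γ :=
  csSup_le' fun _ h => h.2

theorem le_lastIn (hx : x ∈ E) (h : x ≤ γ) : x ≤ lastIn E γ :=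
  le_csSup ⟨γ, fun _ h => h.2⟩ ⟨hx, h⟩

theorem lastIn_mono (h : E ⊆ F) : lastIn E γ ≤ lastIn F γ :=
  csSup_le' fun _ hx => le_lastIn (h hx.1) hx.2

theorem lastIn_mem (hE : IsClosedIn E o) (hγ : γ < o) (hx : x ∈ E) (h : x ≤ γ) :
    lastIn E γ ∈ E := by
  by_contra hn
  have h0 : x < lastIn E γ := (le_lastIn hx h).lt_of_ne (fun he => hn (he ▸ hx))
  refine hn (hE _ (lastIn_le.trans_lt hγ) (zero_le.trans_lt h0).ne' fun q hq => ?_)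
  obtain ⟨r, hr, hqr⟩ := exists_lt_of_lt_csSup (s := {x | x ∈ E ∧ x ≤ γ}) ⟨x, hx, h⟩ hq
  exact ⟨r, hr.1, hqr, (le_lastIn hr.1 hr.2).lt_of_ne (fun he => hn (he ▸ hr.1))⟩

theorem add_one_lt_of_one_lt_cof (ho : 1 < o.cof) (hp : p < o) : p + 1 < o :=
  (one_lt_cof_iff.1 ho).add_one_lt hp

end Basic

section Club

variable {α : Type v} {o p : Ordinal.{u}} {c : Cardinal.{u}}

theorem IsClubIn.nextIn_lt {E : Set Ordinal.{u}} (hE : IsClubIn E o) (hp : p < o) :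
    nextIn E p < o := by
  exact hE.1 (nextIn_spec (hE.2.2 p hp)).1

theorem isClubIn_biInter (ho : ℵ₀ < o.cof) {T : Set α} (hT : SizeLE T c) (hc : c < o.cof)
    {E : α → Set Ordinal.{u}} (hE : ∀ t ∈ T, IsClubIn (E t) o) :
    IsClubIn {p | p < o ∧ ∀ t ∈ T, p ∈ E t} o := by
  refine ⟨fun p hp => hp.1, ?_, ?_⟩
  · intro p hp hp0 h
    refine ⟨hp, fun t ht => (hE t ht).2.1 p hp hp0 fun q hq => ?_⟩
    obtain ⟨r, hr, h⟩ := h q hq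
    exact ⟨r, hr.2 t ht, h⟩
  · have hb : ∀ q, ∃ z, q < o → z < o ∧ ∀ t ∈ T, nextIn (E t) q < z := by
      intro q
      by_cases hq : q < o
      · obtain ⟨z, hz, h⟩ := hT.exists_bound hc (fun t => nextIn (E t) q)
          (fun t ht => (hE t ht).nextIn_lt hq)
        exact ⟨z, fun _ => ⟨hz, h⟩⟩
      · exact ⟨0, fun h => absurd h hq⟩
    choose z hz using hb
    intro p hp
    have h1 : 1 < o.cof := one_lt_aleph0.trans ho
    let f : ℕ → Ordinal.{u} := fun n => Nat.rec p (fun _ q => max (z q) q + 1) n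
    have hf : ∀ n, f n < o := by
      intro n
      induction n with
      | zero => exact hp
      | succ n ih => exact add_one_lt_of_one_lt_cof h1 (max_lt (hz _ ih).1 ih)
    have hfs : ∀ n, max (z (f n)) (f n) < f (n + 1) := fun n => lt_add_one _
    have hlt : ∀ n, f n < ⨆ n, f n := fun n =>
      ((le_max_right _ _).trans_lt (hfs n)).trans_le (Ordinal.le_iSup f (n + 1))
    have hso : ⨆ n, f n < o := by
      refine lift_iSup_lt_of_lt_cof ?_ hf
      simpa using ho
    refine ⟨⨆ n, f n, ⟨hso, fun t ht => ?_⟩, Ordinal.le_iSup f 0⟩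
    refine (hE t ht).2.1 _ hso (zero_le.trans_lt (hlt 0)).ne' fun q hq => ?_
    obtain ⟨n, hn⟩ := Ordinal.lt_iSup_iff.1 hq
    have hn' := nextIn_spec ((hE t ht).2.2 _ (hf n))
    refine ⟨nextIn (E t) (f n), hn'.1, hn.trans_le hn'.2, ?_⟩
    exact ((hz _ (hf n)).2 t ht).trans (((le_max_left _ _).trans_lt (hfs n)).trans (hlt (n + 1)))

theorem IsClubIn.inter (ho : ℵ₀ < o.cof) {E F : Set Ordinal.{u}} (hE : IsClubIn E o)
    (hF : IsClubIn F o) : IsClubIn (E ∩ F) o := by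
  have := isClubIn_biInter (T := (univ : Set Bool)) (E := fun b => if b then E else F) ho
    (SizeLE.of_countable (to_countable _) le_rfl) ho (by intro t _; cases t <;> simpa)
  convert this using 1
  ext p
  simp only [mem_inter_iff, mem_univ, forall_const, Bool.forall_bool, mem_ofPred_eq]
  constructor
  · rintro ⟨h, h'⟩
    exact ⟨hE.1 h, by simpa using h', by simpa using h⟩
  · rintro ⟨-, h, h'⟩
    exact ⟨by simpa using h', by simpa using h⟩

theorem isClubIn_diagonal (ho : ℵ₀ < o.cof) (hcard : ∀ q < o, q.card < o.cof)
    {E : Ordinal.{u} → Set Ordinal.{u}} (hE : ∀ q < o, IsClubIn (E q) o) :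
    IsClubIn {p | p < o ∧ p ≠ 0 ∧ ∀ q < p, p ∈ E q} o := by
  have hinter : ∀ q < o, IsClubIn {p | p < o ∧ ∀ t ∈ Iio q, p ∈ E t} o := fun q hq =>
    isClubIn_biInter ho (SizeLE.Iio_ordinal q) (hcard q hq) (fun t ht => hE t (lt_trans ht hq))
  refine ⟨fun p hp => hp.1, ?_, ?_⟩
  · intro p hp hp0 h
    refine ⟨hp, hp0, fun q hq => (hE q (hq.trans hp)).2.1 p hp hp0 fun s hs => ?_⟩
    obtain ⟨r, hr, hsr, hrp⟩ := h (max q s) (max_lt hq hs)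
    exact ⟨r, hr.2.2 q ((le_max_left _ _).trans_lt hsr), (le_max_right _ _).trans_lt hsr, hrp⟩
  · intro p hp
    have h1 : 1 < o.cof := one_lt_aleph0.trans ho
    let g : Ordinal.{u} → Ordinal.{u} := fun q => nextIn {p | p < o ∧ ∀ t ∈ Iio q, p ∈ E t} q
    let f : ℕ → Ordinal.{u} := fun n => Nat.rec p (fun _ q => g (q + 1)) n
    have hf : ∀ n, f n < o := by
      intro n
      induction n with
      | zero => exact hp
      | succ n ih =>
        have := add_one_lt_of_one_lt_cof h1 ih
        exact (hinter _ this).nextIn_lt this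
    have hfs : ∀ n, f (n + 1) ∈ {p | p < o ∧ ∀ t ∈ Iio (f n + 1), p ∈ E t} ∧ f n + 1 ≤ f (n + 1) :=
      fun n => nextIn_spec ((hinter _ (add_one_lt_of_one_lt_cof h1 (hf n))).2.2 _
        (add_one_lt_of_one_lt_cof h1 (hf n)))
    have hmono : StrictMono f := strictMono_nat_of_lt_succ fun n =>
      (lt_add_one _).trans_le (hfs n).2
    have hlt : ∀ n, f n < ⨆ n, f n := fun n =>
      (hmono (Nat.lt_succ_self n)).trans_le (Ordinal.le_iSup f (n + 1))
    have hso : ⨆ n, f n < o := by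
      refine lift_iSup_lt_of_lt_cof ?_ hf
      simpa using ho
    have h0 : ⨆ n, f n ≠ 0 := (zero_le.trans_lt (hlt 0)).ne'
    refine ⟨⨆ n, f n, ⟨hso, h0, fun q hq => ?_⟩, Ordinal.le_iSup f 0⟩
    refine (hE q (hq.trans hso)).2.1 _ hso h0 fun s hs => ?_
    obtain ⟨n, hn⟩ := Ordinal.lt_iSup_iff.1 hq
    obtain ⟨m, hm⟩ := Ordinal.lt_iSup_iff.1 hs
    refine ⟨f (max n m + 1), (hfs _).1.2 q ?_, hm.trans_le ?_, hlt (max n m + 1)⟩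
    · exact (hn.trans_le (hmono.monotone (le_max_left _ _))).trans (lt_add_one _)
    · exact hmono.monotone ((le_max_right _ _).trans (Nat.le_succ _))

/-- Points closed under an arbitrary function form a club in a regular ordinal. -/
theorem isClubIn_closurePoints_of_regular (ho : ℵ₀ < o.cof) (hcard : ∀ q < o, q.card < o.cof)
    (g : Ordinal.{u} → Ordinal.{u}) (hgo : ∀ q < o, g q < o) :
    IsClubIn {p | p < o ∧ p ≠ 0 ∧ ∀ q < p, g q < p} o := by
  have h1 : 1 < o.cof := one_lt_aleph0.trans ho
  have := isClubIn_diagonal ho hcard (E := fun q => {p | p < o ∧ g q < p}) ?_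
  · convert this using 1
    ext p
    constructor
    · rintro ⟨h, h0, h'⟩
      exact ⟨h, h0, fun q hq => ⟨h, h' q hq⟩⟩
    · rintro ⟨h, h0, h'⟩
      exact ⟨h, h0, fun q hq => (h' q hq).2⟩
  · intro q hq
    refine ⟨fun p hp => hp.1, fun p hp hp0 h => ?_, fun p hp => ?_⟩
    · obtain ⟨r, hr, -, hrp⟩ := h 0 (pos_iff_ne_zero.2 hp0)
      exact ⟨hp, hr.2.trans hrp⟩
    · refine ⟨max p (g q + 1), ⟨max_lt hp (add_one_lt_of_one_lt_cof h1 (hgo q hq)), ?_⟩,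
        le_max_left _ _⟩
      exact (lt_add_one _).trans_le (le_max_right _ _)

/-- Fodor's lemma, in the form used for pressing down a regressive parameter. -/
theorem exists_stationary_of_forall_club (ho : ℵ₀ < o.cof) (hcard : ∀ q < o, q.card < o.cof)
    (Q : ℕ → Ordinal.{u} → Ordinal.{u} → Prop)
    (hQ : ∀ E, IsClubIn E o → ∃ x ∈ E, ∃ n, ∃ η < x, Q n η x) :
    ∃ n, ∃ η < o, IsStationaryIn {x | x < o ∧ Q n η x} o := by
  by_contra! H
  have : ∀ n η, ∃ C, η < o → IsClubIn C o ∧ ∀ x ∈ C, ¬ Q n η x := by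
    intro n η
    by_cases hη : η < o
    · have := H n η hη
      simp only [IsStationaryIn, not_and, not_forall] at this
      obtain ⟨C, hC, hC'⟩ := this (fun x hx => hx.1)
      exact ⟨C, fun _ => ⟨hC, fun x hx hq => hC' ⟨x, ⟨hC.1 hx, hq⟩, hx⟩⟩⟩
    · exact ⟨∅, fun h => absurd h hη⟩
  choose C hC using this
  have h1 : ∀ η < o, IsClubIn {p | p < o ∧ ∀ n ∈ (univ : Set ℕ), p ∈ C n η} o := fun η hη =>
    isClubIn_biInter ho (SizeLE.of_countable (to_countable _) le_rfl) ho
      (fun n _ => (hC n η hη).1)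
  obtain ⟨x, hx, n, η, hη, hq⟩ := hQ _ (isClubIn_diagonal ho hcard h1)
  exact (hC n η (hη.trans hx.1)).2 x ((hx.2.2 η hη).2 n trivial) hq

end Club


theorem exists_recursion {β : Type v} (G : Set β → β) :
    ∃ E : Ordinal.{u} → β, ∀ ξ, E ξ = G (E '' Iio ξ) := by
  refine ⟨Ordinal.lt_wf.fix fun ξ ih => G (range fun ζ : Iio ξ => ih ζ.1 ζ.2), fun ξ => ?_⟩
  rw [WellFounded.fix_eq]
  congr 1
  ext y
  simp

/-- Every ordinal has a club subset of size its cofinality. -/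
theorem exists_isClubIn_sizeLE (γ : Ordinal.{u}) :
    ∃ e, IsClubIn e γ ∧ SizeLE e (max ℵ₀ γ.cof) := by
  obtain ⟨X, hXγ, hX, hXc⟩ := exists_unbounded_sizeLE_cof γ
  let L : Set Ordinal.{u} := {p | p < γ ∧ ∀ q < p, ∃ r ∈ X, q < r ∧ r < p}
  refine ⟨X ∪ {p | p ∈ L ∧ p ≠ 0}, ⟨?_, ?_, fun p hp => ?_⟩, ?_⟩
  · rintro p (hp | hp)
    · exact hXγ hp
    · exact hp.1.1
  · intro p hp hp0 h
    refine Or.inr ⟨⟨hp, fun q hq => ?_⟩, hp0⟩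
    obtain ⟨r, hr | hr, hqr, hrp⟩ := h q hq
    · exact ⟨r, hr, hqr, hrp⟩
    · obtain ⟨s, hs, hqs, hsr⟩ := hr.1.2 q hqr
      exact ⟨s, hs, hqs, hsr.trans hrp⟩
  · obtain ⟨q, hq, h⟩ := hX p hp
    exact ⟨q, Or.inl hq, h⟩
  · refine SizeLE.union (le_max_left _ _) (hXc.mono_card (le_max_right _ _)) ?_
    refine SizeLE.mono ?_ (fun p hp => hp.1 : {p | p ∈ L ∧ p ≠ 0} ⊆ L)
    have key : ∀ p ∈ L, ∀ p' ∈ L, p < p' → nextIn X p < nextIn X p' := by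
      intro p hp p' hp' hlt
      obtain ⟨r, hr, hpr, hrp⟩ := hp'.2 p hlt
      exact (nextIn_le hr hpr.le).trans_lt (hrp.trans_le (nextIn_spec (hX p' hp'.1)).2)
    refine (hXc.mono_card (le_max_right _ _)).of_injOn (nextIn X) ?_ fun p hp =>
      (nextIn_spec (hX p hp.1)).1
    intro p hp p' hp' h
    rcases lt_trichotomy p p' with hl | hl | hl
    · exact absurd h (key p hp p' hp' hl).ne
    · exact hl
    · exact absurd h (key p' hp' p hp hl).ne'

theorem exists_filtration {lam : Cardinal.{u}} {μ : ℕ → Cardinal.{u}} (hmono : Monotone μ)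
    (hinf : ∀ n, ℵ₀ ≤ μ n) (hcof : ∀ κ < lam, ∃ n, κ < μ n) {γ : Ordinal.{u}}
    (hγ : γ.card ≤ lam)
    {e : Set Ordinal.{u}} (heγ : e ⊆ Iio γ) (he : SizeLE e (max ℵ₀ γ.cof)) :
    ∃ F : ℕ → Set Ordinal.{u}, Monotone F ∧ (∀ n, F n ⊆ Iio γ) ∧ (∀ n, SizeLE (F n) (μ n)) ∧
      (∀ α < γ, ∃ n, α ∈ F n) ∧ ∀ n, γ.cof ≤ μ n → e ⊆ F n := by
  obtain ⟨ι, f, hι, hf⟩ := (SizeLE.Iio_ordinal γ).mono_card hγ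
  have : #ι ≤ #lam.ord.ToType := by simpa using hι
  obtain ⟨i⟩ := this
  let g : ι → Ordinal.{u} := fun x => (Ordinal.ToType.mk.symm (i x) : Ordinal)
  have hg : Function.Injective g := fun x y h =>
    i.injective (Ordinal.ToType.mk.symm.injective (Subtype.ext h))
  have hglt : ∀ x, g x < lam.ord := fun x => (Ordinal.ToType.mk.symm (i x)).2
  refine ⟨fun n => {α | α < γ ∧ ((∃ x, f x = α ∧ g x < (μ n).ord) ∨ (γ.cof ≤ μ n ∧ α ∈ e))},
    ?_, fun n α hα => hα.1, fun n => ?_, fun α hα => ?_, fun n hn α hα => ⟨heγ hα, Or.inr ⟨hn, hα⟩⟩⟩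
  · rintro n m hnm α ⟨hα, ⟨x, hx, hx'⟩ | ⟨h, h'⟩⟩
    · exact ⟨hα, Or.inl ⟨x, hx, hx'.trans_le (ord_le_ord.2 (hmono hnm))⟩⟩
    · exact ⟨hα, Or.inr ⟨h.trans (hmono hnm), h'⟩⟩
  · have h1 : SizeLE (f '' {x | g x < (μ n).ord}) (μ n) := by
      refine SizeLE.image ?_ f
      refine SizeLE.of_injOn (Z := Iio (μ n).ord) ?_ g hg.injOn fun x hx => hx
      simpa using SizeLE.Iio_ordinal (μ n).ord
    by_cases hn : γ.cof ≤ μ n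
    · refine (h1.union (hinf n) (he.mono_card (max_le (hinf n) hn))).mono ?_
      rintro α ⟨hα, ⟨x, hx, hx'⟩ | ⟨h, h'⟩⟩
      · exact Or.inl ⟨x, hx', hx⟩
      · exact Or.inr h'
    · refine h1.mono ?_
      rintro α ⟨hα, ⟨x, hx, hx'⟩ | ⟨h, h'⟩⟩
      · exact ⟨x, hx', hx⟩
      · exact absurd h hn
  · obtain ⟨x, rfl⟩ := hf hα
    obtain ⟨n, hn⟩ := hcof _ (lt_ord.1 (hglt x))
    exact ⟨n, hα, Or.inl ⟨x, rfl, lt_ord.2 hn⟩⟩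

theorem exists_cof_eq_of_unbounded {o : Ordinal.{u}} {μ : Cardinal.{u}} (hμ : μ.IsRegular)
    (hμo : μ < o.cof) {E : Set Ordinal.{u}} (hEo : E ⊆ Iio o) (hE : ∀ p < o, ∃ q ∈ E, p ≤ q) :
    ∃ p < o, p.cof = μ ∧ ∀ q < p, ∃ r ∈ E, q < r ∧ r < p := by
  obtain ⟨x, hx⟩ := exists_recursion.{u} fun S => nextIn E (strictSup S)
  have key : ∀ i < μ.ord, x i ∈ E ∧ ∀ j < i, x j < x i := by
    intro i
    induction i using WellFoundedLT.induction with
    | ind i ih =>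
      intro hi
      obtain ⟨b, hb, hb'⟩ := (SizeLE.Iio_ordinal i).exists_bound ((lt_ord.1 hi).trans hμo) x
        fun j hj => hEo (ih j hj (lt_trans hj hi)).1
      have h1 : ∀ y ∈ x '' Iio i, y < b := by
        rintro _ ⟨j, hj, rfl⟩
        exact hb' j hj
      have h2 := nextIn_spec (hE (strictSup (x '' Iio i)) ((strictSup_le h1).trans_lt hb))
      rw [← hx] at h2
      exact ⟨h2.1, fun j hj => (lt_strictSup h1 ⟨j, hj, rfl⟩).trans_le h2.2⟩
  have hlim : Order.IsSuccLimit μ.ord := isSuccLimit_ord hμ.aleph0_le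
  let f : Iio μ.ord → Ordinal.{u} := fun i => x i
  have hf : StrictMono f := fun i j hij => (key j j.2).2 i hij
  have hbd : BddAbove (range f) := ⟨o, by
    rintro _ ⟨i, rfl⟩
    exact le_of_lt (hEo (key i i.2).1)⟩
  have hlt : ∀ i (hi : i < μ.ord), x i < ⨆ i, f i := fun i hi =>
    ((key (i + 1) (hlim.add_one_lt hi)).2 i (lt_add_one i)).trans_le
      (le_ciSup hbd ⟨i + 1, hlim.add_one_lt hi⟩)
  refine ⟨⨆ i, f i, ?_, ?_, fun q hq => ?_⟩
  · obtain ⟨b, hb, hb'⟩ := (SizeLE.Iio_ordinal μ.ord).exists_bound (by simpa using hμo) x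
        fun j hj => hEo (key j hj).1
    exact (ciSup_le' fun i : Iio μ.ord => (hb' i.1 i.2).le).trans_lt hb
  · rw [cof_iSup_Iio hf hlim.isSuccPrelimit, hμ.cof_ord]
  · have : Nonempty (Iio μ.ord) := ⟨⟨0, hμ.ord_pos⟩⟩
    obtain ⟨i, hi⟩ := exists_lt_of_lt_ciSup hq
    exact ⟨f i, (key i i.2).1, hi, hlt i i.2⟩


/-- A system of ladders `e` together with filtrations `F` of the ordinals below `lam⁺` into pieces
of sizes `μ n`, where `μ` is a sequence of cardinals converging to `lam`. -/
structure LadderSystem (lam : Cardinal.{u}) where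
  μ : ℕ → Cardinal.{u}
  e : Ordinal.{u} → Set Ordinal.{u}
  F : Ordinal.{u} → ℕ → Set Ordinal.{u}
  μ_strictMono : StrictMono μ
  aleph0_lt : ∀ n, ℵ₀ < μ n
  μ_lt : ∀ n, μ n < lam
  exists_lt_μ : ∀ κ < lam, ∃ n, κ < μ n
  e_club : ∀ γ, IsClubIn (e γ) γ
  e_size : ∀ γ, SizeLE (e γ) (max ℵ₀ γ.cof)
  F_mono : ∀ γ < (Order.succ lam).ord, Monotone (F γ)
  F_lt : ∀ γ < (Order.succ lam).ord, ∀ n, F γ n ⊆ Iio γ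
  F_size : ∀ γ < (Order.succ lam).ord, ∀ n, SizeLE (F γ n) (μ n)
  mem_F : ∀ γ < (Order.succ lam).ord, ∀ α < γ, ∃ n, α ∈ F γ n
  e_subset_F : ∀ γ < (Order.succ lam).ord, ∀ n, γ.cof ≤ μ n → e γ ⊆ F γ n

theorem card_le_of_lt_ord_succ {lam : Cardinal.{u}} {γ : Ordinal.{u}}
    (h : γ < (Order.succ lam).ord) : γ.card ≤ lam :=
  Order.lt_succ_iff.1 (lt_ord.1 h)

theorem exists_converging_sequence {lam : Cardinal.{u}} (hcof : lam.ord.cof = ℵ₀)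
    (hlam : ℵ₀ < lam) :
    ∃ μ : ℕ → Cardinal.{u}, StrictMono μ ∧ (∀ n, ℵ₀ < μ n) ∧ (∀ n, μ n < lam) ∧
      ∀ κ < lam, ∃ n, κ < μ n := by
  have hsucc : ∀ κ < lam, Order.succ κ < lam := by
    intro κ hκ
    refine (Order.succ_le_of_lt hκ).lt_of_ne fun h => ?_
    rcases lt_or_ge κ ℵ₀ with h0 | h0
    · exact absurd (h ▸ hlam) (not_lt.2 (Order.succ_le_of_lt h0))
    · have := (isRegular_succ h0).cof_ord
      rw [h, hcof] at this
      exact hlam.ne this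
  obtain ⟨X, hX, hXc, hXs⟩ := exists_unbounded_sizeLE_cof lam.ord
  rw [hcof] at hXs
  have hne : X.Nonempty := by
    obtain ⟨q, hq, -⟩ := hXc 0 (by simpa using (zero_le.trans_lt hlam))
    exact ⟨q, hq⟩
  obtain ⟨g, hg⟩ := hXs.countable.exists_eq_range hne
  have hglt : ∀ n, (g n).card < lam := fun n => lt_ord.1 (hX (hg ▸ mem_range_self n))
  let μ : ℕ → Cardinal.{u} := fun n =>
    Nat.rec (Order.succ ℵ₀) (fun k κ => Order.succ (max κ (g k).card)) n
  have hμs : ∀ n, μ (n + 1) = Order.succ (max (μ n) (g n).card) := fun _ => rfl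
  have hmono : StrictMono μ := strictMono_nat_of_lt_succ fun n => by
    rw [hμs]
    exact (le_max_left _ _).trans_lt (Order.lt_succ _)
  refine ⟨μ, hmono, fun n => (Order.lt_succ ℵ₀).trans_le (hmono.monotone (Nat.zero_le n)), ?_, ?_⟩
  · intro n
    induction n with
    | zero => exact hsucc _ hlam
    | succ n ih => exact hsucc _ (max_lt ih (hglt n))
  · intro κ hκ
    obtain ⟨q, hq, hκq⟩ := hXc κ.ord (ord_lt_ord.2 hκ)
    obtain ⟨n, rfl⟩ : q ∈ range g := hg ▸ hq
    refine ⟨n + 1, ?_⟩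
    rw [hμs]
    exact (ord_le.1 hκq).trans_lt ((le_max_right _ _).trans_lt (Order.lt_succ _))

theorem exists_ladderSystem {lam : Cardinal.{u}} (hcof : lam.ord.cof = ℵ₀) (hlam : ℵ₀ < lam) :
    Nonempty (LadderSystem lam) := by
  obtain ⟨μ, hμ, hμ0, hμlt, hμc⟩ := exists_converging_sequence hcof hlam
  choose e he hec using exists_isClubIn_sizeLE.{u}
  have : ∀ γ : Ordinal.{u}, ∃ F : ℕ → Set Ordinal.{u}, γ < (Order.succ lam).ord →
      Monotone F ∧ (∀ n, F n ⊆ Iio γ) ∧ (∀ n, SizeLE (F n) (μ n)) ∧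
      (∀ α < γ, ∃ n, α ∈ F n) ∧ ∀ n, γ.cof ≤ μ n → e γ ⊆ F n := by
    intro γ
    by_cases hγ : γ < (Order.succ lam).ord
    · obtain ⟨F, hF⟩ := exists_filtration hμ.monotone (fun n => (hμ0 n).le) hμc
        (card_le_of_lt_ord_succ hγ) (he γ).1 (hec γ)
      exact ⟨F, fun _ => hF⟩
    · exact ⟨fun _ => ∅, fun h => absurd h hγ⟩
  choose F hF using this
  exact ⟨⟨μ, e, F, hμ, hμ0, hμlt, hμc, he, hec, fun γ h => (hF γ h).1, fun γ h => (hF γ h).2.1,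
    fun γ h => (hF γ h).2.2.1, fun γ h => (hF γ h).2.2.2.1, fun γ h => (hF γ h).2.2.2.2⟩⟩

namespace LadderSystem

variable {lam : Cardinal.{u}} (L : LadderSystem lam)

/-- One step of a generalized walk, along a filtration or to the last point of a club in `𝓔`. -/
def Step (𝓔 : Set (Set Ordinal.{u})) (n : ℕ) (γ γ' : Ordinal.{u}) : Prop :=
  γ' ∈ L.F γ n ∨ ∃ E ∈ 𝓔, γ' = lastIn E γ

/-- The ordinals reachable from `β` by a generalized walk. -/
def reach (𝓔 : Set (Set Ordinal.{u})) (β : Ordinal.{u}) (n : ℕ) : Set Ordinal.{u} :=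
  {α | Relation.ReflTransGen (L.Step 𝓔 n) β α}

variable {L} {𝓔 𝓔' : Set (Set Ordinal.{u})} {α β γ : Ordinal.{u}} {m n : ℕ}

theorem self_mem_reach : β ∈ L.reach 𝓔 β n :=
  Relation.ReflTransGen.refl

theorem reach_le (hβ : β < (Order.succ lam).ord) (h : α ∈ L.reach 𝓔 β n) : α ≤ β := by
  induction h with
  | refl => exact le_rfl
  | tail _ hs ih =>
    rcases hs with hs | ⟨E, -, rfl⟩
    · exact (L.F_lt _ (ih.trans_lt hβ) n hs).le.trans ih
    · exact lastIn_le.trans ih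

theorem reach_trans (h : α ∈ L.reach 𝓔 β n) : L.reach 𝓔 α n ⊆ L.reach 𝓔 β n :=
  fun _ hx => Relation.ReflTransGen.trans h hx

theorem reach_mono (h : 𝓔 ⊆ 𝓔') : L.reach 𝓔 β n ⊆ L.reach 𝓔' β n := by
  intro α hα
  refine Relation.ReflTransGen.mono ?_ _ _ hα
  rintro x y (h1 | ⟨E, hE, h1⟩)
  · exact Or.inl h1
  · exact Or.inr ⟨E, h hE, h1⟩

theorem mem_reach_of_mem_F (h : α ∈ L.F β n) : α ∈ L.reach 𝓔 β n :=
  Relation.ReflTransGen.single (Or.inl h)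

theorem reach_size (h𝓔 : 𝓔.Countable) (hβ : β < (Order.succ lam).ord) :
    SizeLE (L.reach 𝓔 β n) (L.μ n) := by
  have h0 := (L.aleph0_lt n).le
  let R : ℕ → Set Ordinal.{u} := fun k =>
    Nat.rec {β} (fun _ S => ⋃ γ ∈ S, (L.F γ n ∪ (fun E => lastIn E γ) '' 𝓔)) k
  have hRs : ∀ k, R (k + 1) = ⋃ γ ∈ R k, (L.F γ n ∪ (fun E => lastIn E γ) '' 𝓔) := fun _ => rfl
  have hR : ∀ k, R k ⊆ L.reach 𝓔 β n ∧ SizeLE (R k) (L.μ n) := by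
    intro k
    induction k with
    | zero =>
      refine ⟨?_, SizeLE.of_countable (countable_singleton β) h0⟩
      intro x hx
      have hx' : x = β := hx
      rw [hx']
      exact self_mem_reach
    | succ k ih =>
      rw [hRs]
      refine ⟨?_, SizeLE.biUnion h0 ih.2 fun γ hγ => ?_⟩
      · intro α hα
        simp only [mem_iUnion] at hα
        obtain ⟨γ, hγ, hα | ⟨E, hE, rfl⟩⟩ := hα
        · exact (ih.1 hγ).tail (Or.inl hα)
        · exact (ih.1 hγ).tail (Or.inr ⟨E, hE, rfl⟩)
      · exact (L.F_size γ ((reach_le hβ (ih.1 hγ)).trans_lt hβ) n).union h0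
          (SizeLE.of_countable (h𝓔.image _) h0)
  refine (SizeLE.iUnion_nat h0 fun k => (hR k).2).mono fun α hα => ?_
  have hα' : Relation.ReflTransGen (L.Step 𝓔 n) β α := hα
  induction hα' with
  | refl => exact mem_iUnion.2 ⟨0, rfl⟩
  | @tail x y hx hs ih =>
    obtain ⟨k, hk⟩ := mem_iUnion.1 (ih hx)
    refine mem_iUnion.2 ⟨k + 1, ?_⟩
    rw [hRs]
    refine mem_biUnion hk ?_
    rcases hs with hs | ⟨E, hE, rfl⟩
    · exact Or.inl hs
    · exact Or.inr ⟨E, hE, rfl⟩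

theorem exists_mem_reach_image {E : Ordinal.{u} → Set Ordinal.{u}}
    {o : Ordinal.{u}} (ho : Order.IsSuccLimit o) (h : α ∈ L.reach (E '' Iio o) β n) :
    ∃ ζ < o, α ∈ L.reach (E '' Iio ζ) β n := by
  induction h with
  | refl => exact ⟨0, ho.bot_lt, self_mem_reach⟩
  | @tail x y hx hs ih =>
    obtain ⟨ζ, hζ, hxζ⟩ := ih
    rcases hs with hs | ⟨_, ⟨ξ, hξ, rfl⟩, rfl⟩
    · exact ⟨ζ, hζ, hxζ.tail (Or.inl hs)⟩
    · refine ⟨max ζ (ξ + 1), max_lt hζ (ho.add_one_lt hξ), ?_⟩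
      refine Relation.ReflTransGen.tail (reach_mono (image_mono
        (Iio_subset_Iio (le_max_left _ _))) hxζ) (Or.inr ⟨_, ⟨ξ, ?_, rfl⟩, rfl⟩)
      exact (lt_add_one ξ).trans_le (le_max_right _ _)

end LadderSystem

theorem cof_ord_succ {lam : Cardinal.{u}} (h : ℵ₀ ≤ lam) :
    (Order.succ lam).ord.cof = Order.succ lam :=
  (isRegular_succ h).cof_ord

/-- A countable family of clubs suffices for the walks to guess every club. -/
theorem LadderSystem.exists_guessing {lam : Cardinal.{u}} (L : LadderSystem lam) :
    ∃ 𝓔 : Set (Set Ordinal.{u}), 𝓔.Countable ∧ ∀ E, IsClubIn E (Order.succ lam).ord →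
      ∃ δ < (Order.succ lam).ord, ∀ n, ∃ b ∈ L.reach 𝓔 δ n, b ∈ E ∧ L.μ n < b.cof := by
  by_contra! H
  have hlam : ℵ₀ < lam := (L.aleph0_lt 0).trans (L.μ_lt 0)
  have hΛ := cof_ord_succ hlam.le
  have hΛ0 : ℵ₀ < (Order.succ lam).ord.cof := by
    rw [hΛ]
    exact hlam.trans (Order.lt_succ _)
  have h1Λ : ℵ₁ < (Order.succ lam).ord.cof := by
    rw [hΛ, ← succ_aleph0]
    exact Order.succ_lt_succ hlam
  have : ∀ 𝓔 : Set (Set Ordinal.{u}), ∃ E, 𝓔.Countable → IsClubIn E (Order.succ lam).ord ∧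
      ∀ δ < (Order.succ lam).ord, ∃ n, ∀ b ∈ L.reach 𝓔 δ n, b ∈ E → b.cof ≤ L.μ n := by
    intro 𝓔
    by_cases h : 𝓔.Countable
    · obtain ⟨E, hE⟩ := H 𝓔 h
      exact ⟨E, fun _ => hE⟩
    · exact ⟨∅, fun h' => absurd h' h⟩
  choose G hG using this
  obtain ⟨E, hE⟩ := exists_recursion.{u} G
  have hcount : ∀ ξ < ω₁, (E '' Iio ξ).Countable := by
    intro ξ hξ
    refine Countable.image ?_ E
    refine SizeLE.countable ((SizeLE.Iio_ordinal ξ).mono_card (Order.lt_succ_iff.1 ?_))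
    rw [succ_aleph0]
    simpa using lt_ord.1 (show ξ < (ℵ₁ : Cardinal.{u}).ord by simpa using hξ)
  have hE1 : ∀ ξ < ω₁, IsClubIn (E ξ) (Order.succ lam).ord := fun ξ hξ => by
    rw [hE]
    exact (hG _ (hcount ξ hξ)).1
  have hω₁ : SizeLE (Iio (ω₁ : Ordinal.{u})) ℵ₁ := by
    simpa using SizeLE.Iio_ordinal (ω₁ : Ordinal.{u})
  have hI := isClubIn_biInter hΛ0 hω₁ h1Λ hE1
  have hp : ∀ n, ∃ p < (Order.succ lam).ord, L.μ n < p.cof ∧ ∀ ξ < ω₁, p ∈ E ξ := by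
    intro n
    obtain ⟨p, hp, hpc, hpl⟩ := exists_cof_eq_of_unbounded (μ := Order.succ (L.μ n))
      (isRegular_succ (L.aleph0_lt n).le)
      (by rw [hΛ]; exact Order.succ_lt_succ (L.μ_lt n)) hI.1 hI.2.2
    have hp0 : p ≠ 0 := by
      rintro rfl
      simp only [cof_zero] at hpc
      exact (Order.succ_ne_bot _) hpc.symm
    exact ⟨p, hp, hpc ▸ Order.lt_succ _, (hI.2.1 p hp hp0 hpl).2⟩
  choose p hpΛ hpc hpE using hp
  obtain ⟨δ, hδ, hpδ⟩ := (SizeLE.of_countable (to_countable (univ : Set ℕ)) le_rfl).exists_bound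
    hΛ0 p fun n _ => hpΛ n
  have hbad : ∀ ξ : Ordinal.{u}, ∃ n, ξ < ω₁ →
      ∀ b ∈ L.reach (E '' Iio ξ) δ n, b ∈ E ξ → b.cof ≤ L.μ n := by
    intro ξ
    by_cases hξ : ξ < ω₁
    · obtain ⟨n, hn⟩ := (hG _ (hcount ξ hξ)).2 δ hδ
      rw [← hE] at hn
      exact ⟨n, fun _ => hn⟩
    · exact ⟨0, fun h => absurd h hξ⟩
  choose N hN using hbad
  have h1 : ℵ₀ < (ω₁ : Ordinal.{u}).cof := by simp
  have hlim : Order.IsSuccLimit (ω₁ : Ordinal.{u}) := one_lt_cof_iff.1 (one_lt_aleph0.trans h1)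
  obtain ⟨n, -, hn⟩ := (SizeLE.of_countable (to_countable (univ : Set ℕ)) le_rfl).exists_fiber h1
    (X := univ) (fun p hp => ⟨p, trivial, hp, le_rfl⟩) N (fun _ _ _ => trivial)
  have hδp : ∃ x ∈ L.reach (E '' Iio ω₁) δ n, p n ≤ x := ⟨δ, self_mem_reach, (hpδ n trivial).le⟩
  obtain ⟨hγD, hpγ⟩ := nextIn_spec hδp
  have hmin : ∀ x ∈ L.reach (E '' Iio ω₁) δ n, p n ≤ x →
      nextIn (L.reach (E '' Iio ω₁) δ n) (p n) ≤ x := fun x hx h => nextIn_le hx h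
  generalize nextIn (L.reach (E '' Iio ω₁) δ n) (p n) = γ at hγD hpγ hmin
  have hγΛ : γ < (Order.succ lam).ord := (reach_le hδ hγD).trans_lt hδ
  have hγE : ∀ ξ < ω₁, γ ∈ E ξ := by
    intro ξ hξ
    have h2 : lastIn (E ξ) γ = γ := by
      refine le_antisymm lastIn_le (hmin _ ?_ (le_lastIn (hpE n ξ hξ) hpγ))
      exact hγD.tail (Or.inr ⟨_, ⟨ξ, hξ, rfl⟩, rfl⟩)
    exact h2 ▸ lastIn_mem (hE1 ξ hξ).2.1 hγΛ (hpE n ξ hξ) hpγ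
  have hγc : L.μ n < γ.cof := by
    by_contra! h
    have heF := L.e_subset_F γ hγΛ n h
    rcases hpγ.eq_or_lt with h3 | h3
    · exact absurd (h3 ▸ hpc n) (not_lt.2 h)
    · obtain ⟨q, hq, hpq⟩ := (L.e_club γ).2.2 _ h3
      exact absurd (hmin q (hγD.tail (Or.inl (heF hq))) hpq) (not_le.2 ((L.e_club γ).1 hq))
  obtain ⟨ζ, hζ, hγζ⟩ := exists_mem_reach_image hlim hγD
  obtain ⟨ξ, -, hξ, hζξ, rfl⟩ := hn ζ hζ
  exact absurd (hN ξ hξ γ (reach_mono (image_mono (Iio_subset_Iio hζξ)) hγζ) (hγE ξ hξ))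
    (not_le.2 hγc)


theorem exists_recursion_of_restrict {β : Type v} (G : ∀ ξ : Ordinal.{u}, (Iio ξ → β) → β) :
    ∃ E : Ordinal.{u} → β, ∀ ξ, E ξ = G ξ fun ζ => E ζ.1 :=
  ⟨Ordinal.lt_wf.fix fun ξ ih => G ξ fun ζ => ih ζ.1 ζ.2, fun _ => WellFounded.fix_eq _ _ _⟩

/-- Construction of a continuous increasing sequence meeting prescribed local requirements. -/
theorem exists_continuous_sequence {o χ : Ordinal.{u}} (hχ : ∀ i < χ, i.card < o.cof)
    (P : (Ordinal.{u} → Ordinal.{u}) → Ordinal.{u} → Ordinal.{u} → Prop)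
    (hlocal : ∀ g g' j z, (∀ k ≤ j, g k = g' k) → P g j z → P g' j z)
    (hmono : ∀ g j z z', z ≤ z' → z' < o → P g j z → P g j z')
    (hex : ∀ g j, j < χ → (∀ k ≤ j, g k < o) → ∃ z < o, P g j z) :
    ∃ x : Ordinal.{u} → Ordinal.{u}, (∀ i < χ, x i < o) ∧
      (∀ i < χ, ∀ j < i, x j < x i ∧ P x j (x i)) ∧
      ∀ i < χ, Order.IsSuccLimit i → ∀ q < x i, ∃ j < i, q < x j := by
  classical
  obtain ⟨x, hx⟩ := exists_recursion_of_restrict.{u} fun i (g : Iio i → Ordinal.{u}) =>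
    sInf {z | ∀ j < i, (fun k => if h : k < i then g ⟨k, mem_Iio.2 h⟩ else 0) j < z ∧
      P (fun k => if h : k < i then g ⟨k, mem_Iio.2 h⟩ else 0) j z}
  have hx' : ∀ i, x i = sInf {z | ∀ j < i, x j < z ∧ P x j z} := by
    intro i
    rw [hx]
    congr 1
    ext z
    refine forall₂_congr fun j hj => ?_
    have h1 : ∀ k ≤ j, (if h : k < i then x k else 0) = x k := fun k hk =>
      dif_pos (hk.trans_lt hj)
    refine and_congr (by simp [hj]) ⟨hlocal _ _ _ _ h1, hlocal _ _ _ _ fun k hk =>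
      (h1 k hk).symm⟩
  have key : ∀ i < χ, x i < o ∧ ∀ j < i, x j < x i ∧ P x j (x i) := by
    intro i
    induction i using WellFoundedLT.induction with
    | ind i ih =>
      intro hi
      have hz : ∀ j, ∃ z, j < i → z < o ∧ P x j z := by
        intro j
        by_cases hj : j < i
        · obtain ⟨z, hz, h⟩ := hex x j (hj.trans hi) fun k hk =>
            (ih k (hk.trans_lt hj) ((hk.trans_lt hj).trans hi)).1
          exact ⟨z, fun _ => ⟨hz, h⟩⟩
        · exact ⟨0, fun h => absurd h hj⟩
      choose z hz using hz
      obtain ⟨b, hb, hb'⟩ := (SizeLE.Iio_ordinal i).exists_bound (hχ i hi)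
        (fun j => max (x j) (z j)) fun j hj => max_lt (ih j hj (lt_trans hj hi)).1 (hz j hj).1
      have hmem : b ∈ {z | ∀ j < i, x j < z ∧ P x j z} := fun j hj =>
        ⟨(le_max_left _ _).trans_lt (hb' j hj),
          hmono _ _ _ _ ((le_max_right _ _).trans (hb' j hj).le) hb (hz j hj).2⟩
      rw [hx' i]
      exact ⟨(csInf_le' hmem).trans_lt hb, csInf_mem (s := {z | ∀ j < i, x j < z ∧ P x j z}) ⟨b, hmem⟩⟩
  refine ⟨x, fun i hi => (key i hi).1, fun i hi => (key i hi).2, fun i hi hlim q hq => ?_⟩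
  by_contra! H
  have hmem : q ∈ {z | ∀ j < i, x j < z ∧ P x j z} := by
    intro j hj
    have hj1 := hlim.add_one_lt hj
    have h1 := (key _ (hj1.trans hi)).2 j (lt_add_one j)
    exact ⟨h1.1.trans_le (H _ hj1), hmono _ _ _ _ (H _ hj1) (hq.trans (key i hi).1) h1.2⟩
  rw [hx' i] at hq
  exact hq.not_ge (csInf_le' hmem)

/-- Club guessing at points of cofinality `κ` below `κ⁺⁺`. -/
theorem exists_club_guessing {κ : Cardinal.{u}} (hκ : κ.IsRegular) :
    ∃ C : Ordinal.{u} → Set Ordinal.{u},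
      ∀ E, IsClubIn E (Order.succ (Order.succ κ)).ord →
        ∃ ε < (Order.succ (Order.succ κ)).ord, ε.cof = κ ∧ C ε ⊆ E ∧ C ε ⊆ Iio ε ∧
          ∀ p < ε, ∃ q ∈ C ε, p ≤ q := by
  by_contra! H
  have hκ1 := isRegular_succ hκ.aleph0_le
  have hκ2 := (isRegular_succ hκ1.aleph0_le).cof_ord
  have hlt1 : κ < Order.succ κ := Order.lt_succ κ
  have hlt2 : Order.succ κ < Order.succ (Order.succ κ) := Order.lt_succ _
  set χ := (Order.succ (Order.succ κ)).ord with hχ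
  have hχ0 : ℵ₀ < χ.cof := hκ2 ▸ hκ1.aleph0_le.trans_lt hlt2
  choose c hcε hc hcs using exists_unbounded_sizeLE_cof.{u}
  let C : Set Ordinal.{u} → Ordinal.{u} → Set Ordinal.{u} := fun E ε =>
    {x | x ∈ E ∧ x ≠ 0 ∧ ∃ γ ∈ c ε, x = lastIn E γ}
  choose G hG hGC using fun E => H (C E)
  obtain ⟨E, hE⟩ := exists_recursion.{u} fun 𝓐 : Set (Set Ordinal.{u}) =>
    G {p | p < χ ∧ ∀ A ∈ 𝓐, p ∈ A}
  let F : Ordinal.{u} → Set Ordinal.{u} := fun ξ => {p | p < χ ∧ ∀ ζ ∈ Iio ξ, p ∈ E ζ}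
  have hEF : ∀ ξ, E ξ = G (F ξ) := by
    intro ξ
    rw [hE]
    congr 1
    ext p
    simp [F]
  have hEclub : ∀ ξ, IsClubIn (E ξ) χ := fun ξ => hEF ξ ▸ hG _
  have hFanti : ∀ ξ ξ', ξ ≤ ξ' → F ξ' ⊆ F ξ := fun ξ ξ' h p hp =>
    ⟨hp.1, fun ζ hζ => hp.2 ζ (lt_of_lt_of_le hζ h)⟩
  have hFclub : ∀ ξ ≤ (Order.succ κ).ord, IsClubIn (F ξ) χ := fun ξ hξ =>
    isClubIn_biInter hχ0 (SizeLE.Iio_ordinal ξ)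
      (by rw [hκ2]; exact (by simpa using card_le_card hξ : ξ.card ≤ Order.succ κ).trans_lt hlt2)
      fun ζ _ => hEclub ζ
  obtain ⟨ε, hεχ, hεκ, hε⟩ := exists_cof_eq_of_unbounded hκ (by rw [hκ2]; exact hlt1.trans hlt2)
    (hFclub _ le_rfl).1 (hFclub _ le_rfl).2.2
  have hstab : ∀ γ, ∃ ξ < (Order.succ κ).ord, ∀ ξ' < (Order.succ κ).ord, ξ ≤ ξ' →
      lastIn (F ξ') γ = lastIn (F ξ) γ := by
    intro γ
    have hne : ((fun ξ => lastIn (F ξ) γ) '' Iio (Order.succ κ).ord).Nonempty :=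
      ⟨_, 0, hκ1.ord_pos, rfl⟩
    obtain ⟨ξ, hξ, h⟩ := csInf_mem hne
    refine ⟨ξ, hξ, fun ξ' hξ' hle => le_antisymm (lastIn_mono (hFanti _ _ hle)) ?_⟩
    have h' : lastIn (F ξ) γ = _ := h
    rw [h']
    exact csInf_le' ⟨ξ', hξ', rfl⟩
  choose st hst hst' using hstab
  obtain ⟨ξ, hξ, hξst⟩ := (hεκ ▸ hcs ε).exists_bound
    (by rw [hκ1.cof_ord]; exact hlt1) st fun γ _ => hst γ
  have hξ1 : ξ + 1 < (Order.succ κ).ord := (isSuccLimit_ord hκ1.aleph0_le).add_one_lt hξ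
  have hsub : C (F ξ) ε ⊆ G (F ξ) := by
    rintro x ⟨hx, hx0, γ, hγ, rfl⟩
    have h1 : lastIn (F ξ) γ = lastIn (F (ξ + 1)) γ :=
      (hst' γ ξ hξ (hξst γ hγ).le).trans
        (hst' γ _ hξ1 ((hξst γ hγ).le.trans (lt_add_one ξ).le)).symm
    rw [h1] at hx0 ⊢
    have h2 : ∃ y ∈ F (ξ + 1), y ≤ γ := by
      by_contra! h3
      refine hx0 ?_
      have : {x | x ∈ F (ξ + 1) ∧ x ≤ γ} = ∅ :=
        eq_empty_of_forall_notMem fun y hy => (h3 y hy.1).not_ge hy.2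
      rw [lastIn, this]
      simp
    obtain ⟨y, hy, hyγ⟩ := h2
    rw [← hEF]
    exact (lastIn_mem (hFclub _ hξ1.le).2.1 (lt_trans (hcε ε hγ) hεχ) hy hyγ).2 ξ (lt_add_one ξ)
  have hsub' : C (F ξ) ε ⊆ Iio ε := by
    rintro x ⟨hx, hx0, γ, hγ, rfl⟩
    exact lt_of_le_of_lt lastIn_le (hcε ε hγ)
  obtain ⟨p, hp, hp'⟩ := hGC (F ξ) ε hεχ hεκ hsub hsub'
  obtain ⟨r, hr, hpr, hrε⟩ := hε p hp
  obtain ⟨γ, hγ, hrγ⟩ := hc ε r hrε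
  have hrF := hFanti _ _ hξ.le hr
  have h1 := le_lastIn hrF hrγ
  refine absurd (hp' (lastIn (F ξ) γ) ⟨?_, ?_, γ, hγ, rfl⟩) (hpr.trans_le h1).not_gt
  · exact lastIn_mem (hFclub ξ hξ.le).2.1 (lt_trans (hcε ε hγ) hεχ) hrF hrγ
  · exact (zero_le.trans_lt (hpr.trans_le h1)).ne'

namespace LadderSystem

variable {lam : Cardinal.{u}}

theorem aleph0_lt_lam (L : LadderSystem lam) : ℵ₀ < lam :=
  (L.aleph0_lt 0).trans (L.μ_lt 0)

theorem succ_lt (L : LadderSystem lam) {κ : Cardinal.{u}} (h : κ < lam) : Order.succ κ < lam := by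
  obtain ⟨n, hn⟩ := L.exists_lt_μ κ h
  exact (Order.succ_le_of_lt hn).trans_lt (L.μ_lt n)

theorem cof_lt (L : LadderSystem lam) {δ : Ordinal.{u}} (hδ : δ < (Order.succ lam).ord) : δ.cof < lam := by
  refine ((cof_le_card δ).trans (card_le_of_lt_ord_succ hδ)).lt_of_ne fun h => ?_
  have h1 : lam.ord.cof = lam := by rw [← h, cof_ord_cof]
  obtain ⟨b, hb, hb'⟩ := SizeLE.exists_bound (o := lam.ord) (c := ℵ₀)
    (SizeLE.of_countable (to_countable (univ : Set ℕ)) le_rfl) (by rw [h1]; exact L.aleph0_lt_lam)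
    (fun n => (L.μ n).ord) (fun n _ => ord_lt_ord.2 (L.μ_lt n))
  obtain ⟨n, hn⟩ := L.exists_lt_μ _ (lt_ord.1 hb)
  exact (lt_ord.2 hn).not_gt (hb' n trivial)

theorem lt_cof_ord_succ (L : LadderSystem lam) {κ : Cardinal.{u}} (h : κ ≤ lam) : κ < (Order.succ lam).ord.cof := by
  rw [cof_ord_succ L.aleph0_lt_lam.le]
  exact Order.lt_succ_iff.2 h

theorem aleph0_lt_cof (L : LadderSystem lam) : ℵ₀ < (Order.succ lam).ord.cof :=
  L.lt_cof_ord_succ L.aleph0_lt_lam.le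

theorem card_lt_cof (L : LadderSystem lam) : ∀ q < (Order.succ lam).ord, q.card < (Order.succ lam).ord.cof :=
  fun _ hq => L.lt_cof_ord_succ (card_le_of_lt_ord_succ hq)

theorem add_one_lt (L : LadderSystem lam) {δ : Ordinal.{u}} (hδ : δ < (Order.succ lam).ord) :
    δ + 1 < (Order.succ lam).ord :=
  add_one_lt_of_one_lt_cof (one_lt_aleph0.trans L.aleph0_lt_cof) hδ

end LadderSystem

/-- A sequence of functions increasing modulo finite sets and compatible with the ladders. -/
structure LadderSystem.Scale {lam : Cardinal.{u}} (L : LadderSystem lam) where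
  f : Ordinal.{u} → ℕ → Ordinal.{u}
  lt_top : ∀ β < (Order.succ lam).ord, ∀ n, f β n < (Order.succ (L.μ n)).ord
  eventually_lt : ∀ β < (Order.succ lam).ord, ∀ α < β, ∀ᶠ n in Filter.atTop, f α n < f β n
  eventually_ladder : ∀ δ < (Order.succ lam).ord, ∀ᶠ n in Filter.atTop,
    ∀ α ∈ L.e δ, f α n < f δ n

theorem LadderSystem.exists_scale {lam : Cardinal.{u}} (L : LadderSystem lam) :
    Nonempty L.Scale := by
  obtain ⟨f, hf⟩ := exists_recursion_of_restrict.{u} fun β (g : Iio β → ℕ → Ordinal.{u}) n =>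
    strictSup {y | ∃ α : Iio β, α.1 ∈ L.F β n ∧ y = g α n}
  have hf' : ∀ β < (Order.succ lam).ord, ∀ n,
      f β n = strictSup ((fun α => f α n) '' L.F β n) := by
    intro β hβ n
    rw [hf]
    refine congrArg strictSup (Set.ext fun y => ?_)
    constructor
    · rintro ⟨α, hα, rfl⟩
      exact ⟨α, hα, rfl⟩
    · rintro ⟨α, hα, rfl⟩
      exact ⟨⟨α, L.F_lt β hβ n hα⟩, hα, rfl⟩
  have htop : ∀ β, β < (Order.succ lam).ord → ∀ n, f β n < (Order.succ (L.μ n)).ord := by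
    intro β
    induction β using WellFoundedLT.induction with | ind β ih
    intro hβ n
    obtain ⟨b, hb, hb'⟩ := (L.F_size β hβ n).exists_bound (o := (Order.succ (L.μ n)).ord)
      (by rw [cof_ord_succ (L.aleph0_lt n).le]; exact Order.lt_succ _) (fun α => f α n)
      (fun α hα => ih α (L.F_lt β hβ n hα) ((L.F_lt β hβ n hα).trans hβ) n)
    rw [hf' β hβ]
    refine (strictSup_le ?_).trans_lt hb
    rintro _ ⟨α, hα, rfl⟩
    exact hb' α hα
  have hlt : ∀ β < (Order.succ lam).ord, ∀ n, ∀ α ∈ L.F β n, f α n < f β n := by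
    intro β hβ n α hα
    rw [hf' β hβ]
    refine lt_strictSup (z := (Order.succ (L.μ n)).ord) ?_ ⟨α, hα, rfl⟩
    rintro _ ⟨α, hα, rfl⟩
    exact htop α ((L.F_lt β hβ n hα).trans hβ) n
  refine ⟨⟨f, htop, ?_, ?_⟩⟩
  · intro β hβ α hα
    obtain ⟨m, hm⟩ := L.mem_F β hβ α hα
    filter_upwards [Filter.eventually_ge_atTop m] with n hn
    exact hlt β hβ n α (L.F_mono β hβ hn hm)
  · intro δ hδ
    obtain ⟨m, hm⟩ := L.exists_lt_μ _ (L.cof_lt hδ)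
    filter_upwards [Filter.eventually_ge_atTop m] with n hn α hα
    exact hlt δ hδ n α (L.e_subset_F δ hδ n (hm.le.trans (L.μ_strictMono.monotone hn)) hα)

namespace LadderSystem.Scale

open Filter

variable {lam : Cardinal.{u}} {L : LadderSystem lam} (s : L.Scale)

theorem eventually_le {α β : Ordinal.{u}} (hβ : β < (Order.succ lam).ord) (h : α ≤ β) :
    ∀ᶠ n in atTop, s.f α n ≤ s.f β n := by
  rcases h.eq_or_lt with rfl | h
  · exact Eventually.of_forall fun _ => le_rfl
  · exact (s.eventually_lt β hβ α h).mono fun _ h => h.le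

/-- Sequences of small sets are eventually not crossed by the scale. -/
theorem exists_stable {c : Cardinal.{u}} (hc : ℵ₀ ≤ c) (hcl : c < lam)
    {A : ℕ → Set Ordinal.{u}} (hA : ∀ n, SizeLE (A n) c) :
    ∃ α₀ < (Order.succ lam).ord, ∀ α < (Order.succ lam).ord, α₀ ≤ α →
      ∀ᶠ n in atTop, ∀ a ∈ A n, s.f α₀ n ≤ a → s.f α n ≤ a := by
  by_contra! H
  set Λ := (Order.succ lam).ord with hΛ
  have hκ : (Order.succ c).IsRegular := isRegular_succ hc
  obtain ⟨C, hC⟩ := exists_club_guessing hκ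
  set χ := (Order.succ (Order.succ (Order.succ c))).ord with hχ
  have hχreg : (Order.succ (Order.succ (Order.succ c))).IsRegular :=
    isRegular_succ (hc.trans ((Order.le_succ c).trans (Order.le_succ _)))
  have hχcof : χ.cof = Order.succ (Order.succ (Order.succ c)) := hχreg.cof_ord
  have hcχ : c < χ.cof := by
    rw [hχcof]
    exact ((Order.lt_succ c).trans (Order.lt_succ _)).trans (Order.lt_succ _)
  have hχ0 : ℵ₀ < χ.cof := hc.trans_lt hcχ
  have hχs : ∀ i < χ, i + 1 < χ := fun i =>
    add_one_lt_of_one_lt_cof (one_lt_aleph0.trans hχ0)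
  have hχΛ : χ.card < Λ.cof := by
    rw [hχ, card_ord]
    exact L.lt_cof_ord_succ (L.succ_lt (L.succ_lt (L.succ_lt hcl))).le
  let Ch : Ordinal.{u} → Ordinal.{u} → Prop := fun α z =>
    ∃ᶠ n in atTop, ∃ a ∈ A n, s.f α n ≤ a ∧ a < s.f z n
  have hChmono : ∀ α z z', z ≤ z' → z' < Λ → Ch α z → Ch α z' := by
    intro α z z' hzz hz' h
    refine (h.and_eventually (s.eventually_le hz' hzz)).mono ?_
    rintro n ⟨⟨a, ha, h1, h2⟩, h3⟩
    exact ⟨a, ha, h1, h2.trans_le h3⟩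
  let B : (Ordinal.{u} → Ordinal.{u}) → Ordinal.{u} → Ordinal.{u} → ℕ → Ordinal.{u} :=
    fun g ε j n => sSup ((fun i => s.f (g i) n) '' (C ε ∩ Iic j))
  obtain ⟨x, hxΛ, hxP, hxlim⟩ := exists_continuous_sequence (o := Λ) (χ := χ)
    (fun i hi => (card_le_card hi.le).trans_lt hχΛ)
    (fun g j z => Ch (g j) z ∧ ∀ ε < χ, (∃ η < Λ, ∀ᶠ n in atTop, B g ε j n ≤ s.f η n) →
      ∀ᶠ n in atTop, B g ε j n ≤ s.f z n)
    (by
      intro g g' j z hg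
      have : ∀ ε n, B g ε j n = B g' ε j n := by
        intro ε n
        refine congrArg sSup (image_congr fun i hi => ?_)
        simp only [hg i hi.2]
      simp only [this, hg j le_rfl, imp_self])
    (by
      rintro g j z z' hzz hz' ⟨h1, h2⟩
      refine ⟨hChmono _ _ _ hzz hz' h1, fun ε hε h => ?_⟩
      filter_upwards [h2 ε hε h, s.eventually_le hz' hzz] with n h3 h4
      exact h3.trans h4)
    (by
      intro g j hj hg
      obtain ⟨z₁, hz₁, hgz, hz⟩ := H (g j) (hg j le_rfl)
      have : ∀ ε, ∃ η < Λ, (∃ η < Λ, ∀ᶠ n in atTop, B g ε j n ≤ s.f η n) →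
          ∀ᶠ n in atTop, B g ε j n ≤ s.f η n := by
        intro ε
        by_cases h : ∃ η < Λ, ∀ᶠ n in atTop, B g ε j n ≤ s.f η n
        · obtain ⟨η, hη, h'⟩ := h
          exact ⟨η, hη, fun _ => h'⟩
        · exact ⟨z₁, hz₁, fun h' => absurd h' h⟩
      choose η hη hη' using this
      obtain ⟨z₂, hz₂, hz₂'⟩ := (SizeLE.Iio_ordinal χ).exists_bound hχΛ η (fun ε _ => hη ε)
      have hm : max z₁ z₂ < Λ := max_lt hz₁ hz₂
      refine ⟨max z₁ z₂, hm, hChmono _ z₁ _ (le_max_left _ _) hm hz, fun ε hε h => ?_⟩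
      filter_upwards [hη' ε h, s.eventually_le hm ((hz₂' ε hε).le.trans (le_max_right _ _))]
        with n h3 h4
      exact h3.trans h4)
  have hxmono : ∀ i < χ, ∀ j < i, x j < x i := fun i hi j hj => (hxP i hi j hj).1
  have hxle : ∀ i < χ, ∀ j ≤ i, x j ≤ x i := fun i hi j hj =>
    hj.eq_or_lt.elim (fun h => h ▸ le_rfl) fun h => (hxmono i hi j h).le
  obtain ⟨δ', hδ', hδ'x⟩ := (SizeLE.Iio_ordinal χ).exists_bound hχΛ x hxΛ
  set δ := strictSup (x '' Iio χ) with hδdef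
  have hub : ∀ y ∈ x '' Iio χ, y < δ' := by
    rintro _ ⟨i, hi, rfl⟩
    exact hδ'x i hi
  have hδ : δ < Λ := (strictSup_le hub).trans_lt hδ'
  have hxδ : ∀ i < χ, x i < δ := fun i hi => lt_strictSup hub ⟨i, hi, rfl⟩
  have hδx : ∀ q < δ, ∃ i < χ, q < x i := by
    intro q hq
    by_contra! h
    refine hq.not_ge (strictSup_le ?_)
    rintro _ ⟨i, hi, rfl⟩
    exact (hxmono _ (hχs i hi) i (lt_add_one i)).trans_le (h _ (hχs i hi))
  have : ∀ q, ∃ i, q < χ → i < χ ∧ nextIn (L.e δ) (x q) < x i := by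
    intro q
    by_cases hq : q < χ
    · obtain ⟨i, hi, h⟩ := hδx _ ((L.e_club δ).nextIn_lt (hxδ q hq))
      exact ⟨i, fun _ => ⟨hi, h⟩⟩
    · exact ⟨0, fun h => absurd h hq⟩
  choose G hG using this
  have hnext : ∀ q < χ, nextIn (L.e δ) (x q) ∈ L.e δ ∧ x q ≤ nextIn (L.e δ) (x q) :=
    fun q hq => nextIn_spec ((L.e_club δ).2.2 _ (hxδ q hq))
  have hqG : ∀ q < χ, q < G q := by
    intro q hq
    by_contra! h
    exact ((hnext q hq).2.trans_lt (hG q hq).2).not_ge (hxle q hq _ h)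
  have hclub := isClubIn_closurePoints_of_regular hχ0
    (fun q hq => by rw [hχcof]; exact lt_ord.1 hq) G (fun q hq => (hG q hq).1)
  have hmem : ∀ i, i < χ → i ≠ 0 → (∀ q < i, G q < i) → x i ∈ L.e δ := by
    intro i hi hi0 hiG
    have hlim : Order.IsSuccLimit i := by
      refine ⟨by simpa using hi0, Order.isSuccPrelimit_of_succ_lt fun q hq => ?_⟩
      exact (Order.succ_le_of_lt (hqG q (hq.trans hi))).trans_lt (hiG q hq)
    refine (L.e_club δ).2.1 (x i) (hxδ i hi) ?_ fun q hq => ?_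
    · exact (zero_le.trans_lt (hxmono i hi 0 (pos_iff_ne_zero.2 hi0))).ne'
    · obtain ⟨j, hj, hqj⟩ := hxlim i hi hlim q hq
      have hj' := hj.trans hi
      exact ⟨_, (hnext j hj').1, hqj.trans_le (hnext j hj').2,
        (hG j hj').2.trans (hxmono i hi _ (hiG j hj))⟩
  obtain ⟨ε, hε, hεcof, hCε, hCεlt, hCεu⟩ := hC _ hclub
  have hε0 : ℵ₀ < ε.cof := hεcof ▸ hc.trans_lt (Order.lt_succ c)
  have hεs : ∀ i < ε, i + 1 < ε := fun i =>
    add_one_lt_of_one_lt_cof (one_lt_aleph0.trans hε0)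
  obtain ⟨N, hN⟩ := eventually_atTop.1 (s.eventually_ladder δ hδ)
  have hN' : ∀ n ≥ N, ∀ i ∈ C ε, s.f (x i) n < s.f δ n := fun n hn i hi =>
    hN n hn _ (hmem i (hCε hi).1 (hCε hi).2.1 (hCε hi).2.2)
  have hB : ∀ j, ∃ m, j < ε → ∀ n ≥ m, B x ε j n ≤ s.f (x (j + 1)) n := by
    intro j
    by_cases hj : j < ε
    · have h0 : ∀ᶠ n in atTop, B x ε j n ≤ s.f δ n := by
        refine (eventually_ge_atTop N).mono fun n hn => csSup_le' ?_
        rintro _ ⟨i, hi, rfl⟩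
        exact (hN' n hn i hi.1).le
      obtain ⟨m, hm⟩ := eventually_atTop.1
        ((hxP (j + 1) ((hεs j hj).trans hε) j (lt_add_one j)).2.2 ε hε ⟨δ, hδ, h0⟩)
      exact ⟨m, fun _ => hm⟩
    · exact ⟨0, fun h => absurd h hj⟩
  choose M hM using hB
  have hle : ∀ j < ε, ∀ i ∈ C ε, i ≤ j → ∀ n ≥ N, M j ≤ n →
      s.f (x i) n ≤ s.f (x (j + 1)) n := by
    intro j hj i hi hij n hn hMn
    refine le_trans (le_csSup (s := (fun i => s.f (x i) n) '' (C ε ∩ Iic j)) ⟨s.f δ n, ?_⟩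
      ⟨i, ⟨hi, hij⟩, rfl⟩) (hM j hj n hMn)
    rintro _ ⟨i, hi, rfl⟩
    exact (hN' n hn i hi.1).le
  have huniv : SizeLE (univ : Set ℕ) ℵ₀ := SizeLE.of_countable (to_countable _) le_rfl
  obtain ⟨m, -, hm⟩ := huniv.exists_fiber hε0 (X := C ε)
    (fun p hp => by
      obtain ⟨q, hq, hpq⟩ := hCεu p hp
      exact ⟨q, hq, hCεlt hq, hpq⟩) M (fun _ _ _ => trivial)
  have hk : ∀ j, ∃ k n a, j < ε → k ∈ C ε ∧ k < ε ∧ N ≤ n ∧ m ≤ n ∧ a ∈ A n ∧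
      s.f (x (j + 1)) n ≤ a ∧ a < s.f (x k) n := by
    intro j
    by_cases hj : j < ε
    · have hj1 := hεs j hj
      have hj2 := hεs _ hj1
      obtain ⟨k, hk, hkε, hjk, -⟩ := hm _ hj2
      have h1 : Ch (x (j + 1)) (x k) :=
        hChmono _ _ _ (hxle k (hkε.trans hε) _ hjk) (hxΛ k (hkε.trans hε))
          (hxP _ (hj2.trans hε) _ (lt_add_one (j + 1))).2.1
      obtain ⟨n, ⟨a, ha, h2, h3⟩, h4⟩ := (h1.and_eventually
        (eventually_ge_atTop (max N m))).exists
      exact ⟨k, n, a, fun _ => ⟨hk, hkε, (le_max_left _ _).trans h4,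
        (le_max_right _ _).trans h4, ha, h2, h3⟩⟩
    · exact ⟨0, 0, 0, fun h => absurd h hj⟩
  choose k n a hkna using hk
  obtain ⟨n₀, -, hn₀⟩ := huniv.exists_fiber hε0 (X := {q | q ∈ C ε ∧ M q = m})
    (fun p hp => by
      obtain ⟨q, h1, h2, h3, h4⟩ := hm p hp
      exact ⟨q, ⟨h1, h4⟩, h2, h3⟩) n (fun _ _ _ => trivial)
  obtain ⟨a₀, -, ha₀⟩ := (hA n₀).exists_fiber (hεcof ▸ Order.lt_succ c)
    (X := {q | q ∈ C ε ∧ M q = m ∧ n q = n₀})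
    (fun p hp => by
      obtain ⟨q, h1, h2, h3, h4⟩ := hn₀ p hp
      exact ⟨q, ⟨h1.1, h1.2, h4⟩, h2, h3⟩) a
    (fun q hq hqε => hq.2.2 ▸ (hkna q hqε).2.2.2.2.1)
  obtain ⟨j, hj, hjε, -, haj⟩ := ha₀ 0 (zero_le.trans_lt (hεs 0 (by
    refine pos_iff_ne_zero.2 ?_
    rintro rfl
    simp at hε0)))
  obtain ⟨hk1, hk2, hk3, hk4, -, -, hk7⟩ := hkna j hjε
  obtain ⟨j', hj', hj'ε, hkj', haj'⟩ := ha₀ _ hk2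
  obtain ⟨-, -, -, -, -, hk6, -⟩ := hkna j' hj'ε
  rw [haj, hj.2.2] at hk7
  rw [haj', hj'.2.2] at hk6
  rw [hj.2.2] at hk3 hk4
  exact (hk7.trans_le ((hle j' hj'ε _ hk1 hkj' n₀ hk3 (hj'.2.1 ▸ hk4)).trans hk6)).false

end LadderSystem.Scale

namespace LadderSystem.Scale

open Filter

variable {lam : Cardinal.{u}} {L : LadderSystem lam} (s : L.Scale)

/-- Every scale has an exact upper bound. -/
theorem exists_eub : ∃ b : ℕ → Ordinal.{u}, (∀ n, b n ≤ (Order.succ (L.μ n)).ord) ∧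
    (∀ α < (Order.succ lam).ord, ∀ᶠ n in atTop, s.f α n < b n) ∧
    ∀ h : ℕ → Ordinal.{u}, (∀ᶠ n in atTop, h n < b n) →
      ∃ α < (Order.succ lam).ord, ∀ᶠ n in atTop, h n ≤ s.f α n := by
  by_contra! H
  set Λ := (Order.succ lam).ord with hΛ
  let A : Set (ℕ → Ordinal.{u}) → ℕ → Set Ordinal.{u} := fun 𝓐 n =>
    insert (Order.succ (L.μ n)).ord ((fun h => h n) '' 𝓐)
  have hAmono : ∀ 𝓐 𝓑 n, 𝓐 ⊆ 𝓑 → A 𝓐 n ⊆ A 𝓑 n := fun 𝓐 𝓑 n h =>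
    insert_subset_insert (image_mono h)
  have : ∀ 𝓐 : Set (ℕ → Ordinal.{u}), ∃ α < Λ, 𝓐.Countable → ∀ α' < Λ, α ≤ α' →
      ∀ᶠ n in atTop, ∀ a ∈ A 𝓐 n, s.f α n ≤ a → s.f α' n ≤ a := by
    intro 𝓐
    by_cases h : 𝓐.Countable
    · obtain ⟨α, hα, h'⟩ := s.exists_stable le_rfl L.aleph0_lt_lam (A := A 𝓐)
        (fun n => SizeLE.of_countable ((h.image _).insert _) le_rfl)
      exact ⟨α, hα, fun _ => h'⟩
    · exact ⟨0, (lt_ord.2 (by rw [card_zero]; exact Order.bot_lt_succ lam)), fun h' => absurd h' h⟩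
  choose α hα hstab using this
  let b : Set (ℕ → Ordinal.{u}) → ℕ → Ordinal.{u} := fun 𝓐 n => nextIn (A 𝓐 n) (s.f (α 𝓐) n)
  have hex : ∀ 𝓐 n p, p < (Order.succ (L.μ n)).ord → ∃ x ∈ A 𝓐 n, p ≤ x := fun 𝓐 n p hp =>
    ⟨_, mem_insert _ _, hp.le⟩
  have hb : ∀ 𝓐 n, b 𝓐 n ∈ A 𝓐 n ∧ s.f (α 𝓐) n ≤ b 𝓐 n := fun 𝓐 n =>
    nextIn_spec (hex 𝓐 n _ (s.lt_top _ (hα 𝓐) n))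
  have : ∀ 𝓐 : Set (ℕ → Ordinal.{u}), ∃ h : ℕ → Ordinal.{u}, 𝓐.Countable →
      (∀ᶠ n in atTop, h n < b 𝓐 n) ∧ ∀ α < Λ, ∃ᶠ n in atTop, s.f α n < h n := by
    intro 𝓐
    by_cases h𝓐 : 𝓐.Countable
    · have h1 : ∀ β < Λ, ∀ᶠ n in atTop, s.f β n < b 𝓐 n := by
        intro β hβ
        have hm : max (β + 1) (α 𝓐) < Λ := max_lt (L.add_one_lt hβ) (hα 𝓐)
        filter_upwards [s.eventually_lt _ hm β ((lt_add_one β).trans_le (le_max_left _ _)),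
          hstab 𝓐 h𝓐 _ hm (le_max_right _ _)] with n h2 h3
        exact h2.trans_le (h3 _ (hb 𝓐 n).1 (hb 𝓐 n).2)
      obtain ⟨h, h2, h3⟩ := H (b 𝓐) (fun n => nextIn_le (mem_insert _ _)
        (s.lt_top _ (hα 𝓐) n).le) h1
      exact ⟨h, fun _ => ⟨h2, h3⟩⟩
    · exact ⟨fun _ => 0, fun h => absurd h h𝓐⟩
  choose G hG using this
  obtain ⟨E, hE⟩ := exists_recursion.{u} G
  have hω : (ω₁ : Ordinal.{u}).card = ℵ₁ := by simp
  have hcount : ∀ ξ < (ω₁ : Ordinal.{u}), (E '' Iio ξ).Countable := by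
    intro ξ hξ
    refine ((SizeLE.Iio_ordinal ξ).mono_card ?_).countable.image E
    rw [← Order.lt_succ_iff, succ_aleph0]
    simpa using lt_ord.1 (show ξ < (ℵ₁ : Cardinal.{u}).ord by simpa using hξ)
  obtain ⟨β, hβ, hβ'⟩ := (SizeLE.Iio_ordinal (ω₁ : Ordinal.{u})).exists_bound (o := Λ)
    (by
      rw [hω, ← succ_aleph0]
      exact L.lt_cof_ord_succ (Order.succ_le_of_lt L.aleph0_lt_lam))
    (fun ξ => α (E '' Iio ξ)) (fun ξ _ => hα _)
  have hq : ∀ n, nextIn (A (E '' Iio (ω₁ : Ordinal.{u})) n) (s.f β n) ∈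
      A (E '' Iio (ω₁ : Ordinal.{u})) n ∧
      s.f β n ≤ nextIn (A (E '' Iio (ω₁ : Ordinal.{u})) n) (s.f β n) := fun n =>
    nextIn_spec (hex _ n _ (s.lt_top β hβ n))
  have : ∀ n, ∃ ξ < (ω₁ : Ordinal.{u}),
      nextIn (A (E '' Iio (ω₁ : Ordinal.{u})) n) (s.f β n) ∈ A (E '' Iic ξ) n := by
    intro n
    rcases (hq n).1 with h | ⟨_, ⟨ξ, hξ, rfl⟩, h⟩
    · exact ⟨0, omega_pos 1, Or.inl h⟩
    · exact ⟨ξ, hξ, Or.inr ⟨E ξ, ⟨ξ, mem_Iic.2 le_rfl, rfl⟩, h⟩⟩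
  choose ξ hξ hqξ using this
  obtain ⟨η, hη, hη'⟩ := SizeLE.exists_bound (o := (ω₁ : Ordinal.{u})) (c := ℵ₀)
    (SizeLE.of_countable (to_countable (univ : Set ℕ)) le_rfl)
    (by simp) ξ (fun n _ => hξ n)
  obtain ⟨h1, h2⟩ := hG _ (hcount η hη)
  rw [← hE] at h1 h2
  obtain ⟨n, h3, h4, h5⟩ := ((h2 β hβ).and_eventually
    (h1.and (s.eventually_le hβ (hβ' η hη).le))).exists
  have h6 : b (E '' Iio η) n ≤ nextIn (A (E '' Iio (ω₁ : Ordinal.{u})) n) (s.f β n) :=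
    nextIn_le (hAmono _ _ n (image_mono fun x hx => lt_of_le_of_lt hx (hη' n trivial)) (hqξ n))
      (h5.trans (hq n).2)
  have h7 : nextIn (A (E '' Iio (ω₁ : Ordinal.{u})) n) (s.f β n) ≤ E η n :=
    nextIn_le (Or.inr ⟨E η, ⟨η, hη, rfl⟩, rfl⟩) h3.le
  exact (h4.trans_le (h6.trans h7)).false

theorem eventually_lt_cof_eub {b : ℕ → Ordinal.{u}}
    (hlt : ∀ α < (Order.succ lam).ord, ∀ᶠ n in atTop, s.f α n < b n)
    (hexact : ∀ h : ℕ → Ordinal.{u}, (∀ᶠ n in atTop, h n < b n) →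
      ∃ α < (Order.succ lam).ord, ∀ᶠ n in atTop, h n ≤ s.f α n)
    {c : Cardinal.{u}} (hc : c < lam) : ∀ᶠ n in atTop, c < (b n).cof := by
  wlog hc0 : ℵ₀ ≤ c
  · exact (this s hlt hexact L.aleph0_lt_lam le_rfl).mono fun n hn => (not_le.1 hc0).trans hn
  classical
  let A : ℕ → Set Ordinal.{u} := fun n => if (b n).cof ≤ c then L.e (b n) else ∅
  obtain ⟨α, hα, hstab⟩ := s.exists_stable hc0 hc (A := A) (by
    intro n
    simp only [A]
    split_ifs with h
    · exact (L.e_size _).mono_card (max_le hc0 h)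
    · exact SizeLE.empty)
  have hnext := fun n (h : s.f α n < b n) => nextIn_spec ((L.e_club (b n)).2.2 _ h)
  obtain ⟨β, hβ, hle⟩ := hexact (fun n => nextIn (L.e (b n)) (s.f α n))
    ((hlt α hα).mono fun n hn => (L.e_club (b n)).1 (hnext n hn).1)
  have hm : max α β + 1 < (Order.succ lam).ord := L.add_one_lt (max_lt hα hβ)
  have hβm : β < max α β + 1 := (le_max_right α β).trans_lt (lt_add_one _)
  have hαm : α ≤ max α β + 1 := (le_max_left α β).trans (lt_add_one _).le
  filter_upwards [hlt α hα, hle, hstab _ hm hαm, s.eventually_lt _ hm β hβm] with n h1 h2 h3 h4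
  by_contra! h5
  have h6 := h3 (nextIn (L.e (b n)) (s.f α n)) (by simp only [A, if_pos h5]; exact (hnext n h1).1)
    (hnext n h1).2
  exact (h4.trans_le (h6.trans h2)).false

end LadderSystem.Scale

open Filter in
/-- A scale in a product of ordinals of uncountable, strictly increasing cofinalities. -/
theorem LadderSystem.exists_increasing_scale {lam : Cardinal.{u}} (L : LadderSystem lam) :
    ∃ (c : ℕ → Ordinal.{u}) (g : Ordinal.{u} → ℕ → Ordinal.{u}),
      StrictMono (fun k => (c k).cof) ∧ (∀ k, ℵ₀ < (c k).cof) ∧ (∀ k, (c k).cof < lam) ∧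
      (∀ β k, g β k < c k) ∧
      ∀ h : ℕ → Ordinal.{u}, (∀ k, h k < c k) → ∃ α < (Order.succ lam).ord,
        ∀ β < (Order.succ lam).ord, α ≤ β → ∀ᶠ k in atTop, h k < g β k := by
  classical
  obtain ⟨s⟩ := L.exists_scale
  obtain ⟨b, hbtop, hlt, hexact⟩ := s.exists_eub
  have hcof := fun c (hc : c < lam) => eventually_atTop.1 (s.eventually_lt_cof_eub hlt hexact hc)
  have hblt : ∀ n, (b n).cof < lam := fun n =>
    ((cof_le_card _).trans (by simpa using card_le_card (hbtop n))).trans_lt (L.succ_lt (L.μ_lt n))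
  obtain ⟨n₀, hn₀⟩ := hcof ℵ₀ L.aleph0_lt_lam
  have : ∀ n, ∃ N, ∀ m ≥ N, (b n).cof < (b m).cof := fun n => hcof _ (hblt n)
  choose N hN using this
  let φ : ℕ → ℕ := fun k => Nat.rec n₀ (fun _ m => max (N m) (m + 1)) k
  have hφ : ∀ k, φ (k + 1) = max (N (φ k)) (φ k + 1) := fun _ => rfl
  have hφm : StrictMono φ := strictMono_nat_of_lt_succ fun k => by rw [hφ]; omega
  have hc0 : ∀ k, ℵ₀ < (b (φ k)).cof := fun k => hn₀ _ (hφm.monotone (Nat.zero_le k))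
  have hpos : ∀ k, 0 < b (φ k) := fun k => by
    rw [pos_iff_ne_zero]
    intro h
    have := hc0 k
    simp [h] at this
  refine ⟨fun k => b (φ k), fun β k => if s.f β (φ k) < b (φ k) then s.f β (φ k) else 0,
    strictMono_nat_of_lt_succ fun k => hN _ _ (by rw [hφ]; exact le_max_left _ _), hc0,
    fun k => hblt _, ?_, ?_⟩
  · intro β k
    dsimp only
    split_ifs with h
    · exact h
    · exact hpos k
  · intro h hh
    have h0 : ∀ᶠ n in atTop, Function.extend φ h (fun _ => 0) n < b n := by
      filter_upwards [eventually_ge_atTop n₀] with n hn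
      rcases em (∃ k, φ k = n) with hr | hr
      · obtain ⟨k, rfl⟩ := hr
        rw [hφm.injective.extend_apply]
        exact hh k
      · rw [Function.extend_apply' _ _ _ hr, pos_iff_ne_zero]
        intro h
        have := hn₀ n hn
        simp [h] at this
    obtain ⟨α, hα, hle⟩ := hexact _ h0
    refine ⟨α + 1, L.add_one_lt hα, fun β hβ hαβ => ?_⟩
    filter_upwards [hφm.tendsto_atTop.eventually hle, hφm.tendsto_atTop.eventually (hlt β hβ),
      hφm.tendsto_atTop.eventually (s.eventually_lt β hβ α ((lt_add_one α).trans_le hαβ))]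
      with k h1 h2 h3
    rw [hφm.injective.extend_apply] at h1
    rw [if_pos h2]
    exact h1.trans_lt h3

open Filter in
/-- A colouring of pairs taking every value on `A × {β}` below a fixed bound, for all large `β`. -/
theorem LadderSystem.exists_coloring {lam : Cardinal.{u}} (L : LadderSystem lam) :
    ∃ Γ : Ordinal.{u} → Ordinal.{u} → ℕ, ∀ A ⊆ Iio (Order.succ lam).ord,
      (∀ p < (Order.succ lam).ord, ∃ q ∈ A, p ≤ q) →
      ∃ ζ < (Order.succ lam).ord, ∀ β < (Order.succ lam).ord, ζ ≤ β →
        ∀ n, ∃ α ∈ A, α < ζ ∧ Γ α β = n := by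
  classical
  obtain ⟨c, g, hcm, hc0, hclt, hgc, hdom⟩ := L.exists_increasing_scale
  refine ⟨fun α β => (Nat.unpair (sInf {k | ∀ i > k, g α i ≤ g β i})).1, fun A hA hAu => ?_⟩
  have huniv : SizeLE (univ : Set ℕ) ℵ₀ := SizeLE.of_countable (to_countable _) le_rfl
  have hpos : ∀ k, 0 < c k := fun k => zero_le.trans_lt (hgc 0 k)
  have hstep : ∃ k₀, ∀ k ≥ k₀, ∀ ρ < c k, ∃ α ∈ A, ρ < g α k := by
    by_contra! H
    have : ∀ k, ∃ ρ < c k, (∃ ρ < c k, ∀ α ∈ A, g α k ≤ ρ) → ∀ α ∈ A, g α k ≤ ρ := by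
      intro k
      by_cases h : ∃ ρ < c k, ∀ α ∈ A, g α k ≤ ρ
      · obtain ⟨ρ, hρ, h'⟩ := h
        exact ⟨ρ, hρ, fun _ => h'⟩
      · exact ⟨0, hpos k, fun h' => absurd h' h⟩
    choose h hh hh' using this
    obtain ⟨α₀, hα₀, hd⟩ := hdom h hh
    obtain ⟨α, hα, hle⟩ := hAu α₀ hα₀
    obtain ⟨N, hN⟩ := eventually_atTop.1 (hd α (hA hα) hle)
    obtain ⟨k, hk, hρ⟩ := H N
    exact (hN k hk).not_ge (hh' k hρ α hα)
  obtain ⟨k₀, hk₀⟩ := hstep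
  have : ∀ k ρ, ∃ α, k₀ ≤ k → ρ < c k → α ∈ A ∧ ρ < g α k := by
    intro k ρ
    by_cases h : k₀ ≤ k ∧ ρ < c k
    · obtain ⟨α, hα⟩ := hk₀ k h.1 ρ h.2
      exact ⟨α, fun _ _ => hα⟩
    · exact ⟨0, fun h1 h2 => absurd ⟨h1, h2⟩ h⟩
  choose a ha using this
  choose X hXc hXu hXs using fun k => exists_unbounded_sizeLE_cof (c k)
  have : ∀ i, ∃ z < c i, ∀ k, k₀ ≤ k → k < i → ∀ ρ ∈ X k, g (a k ρ) i < z := by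
    intro i
    have : ∀ k, ∃ z < c i, k < i → ∀ ρ ∈ X k, g (a k ρ) i < z := by
      intro k
      by_cases hk : k < i
      · obtain ⟨z, hz, h⟩ := (hXs k).exists_bound (hcm hk) (fun ρ => g (a k ρ) i)
          (fun ρ _ => hgc _ i)
        exact ⟨z, hz, fun _ => h⟩
      · exact ⟨0, hpos i, fun h => absurd h hk⟩
    choose z hz hz' using this
    obtain ⟨z₁, hz₁, h⟩ := huniv.exists_bound (hc0 i) z (fun k _ => hz k)
    exact ⟨z₁, hz₁, fun k _ hk ρ hρ => (hz' k hk ρ hρ).trans (h k trivial)⟩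
  choose z hz hz' using this
  obtain ⟨α₀, hα₀, hd⟩ := hdom z hz
  have : ∀ k, ∃ ζ < (Order.succ lam).ord, k₀ ≤ k → ∀ ρ ∈ X k, a k ρ < ζ := by
    intro k
    by_cases hk : k₀ ≤ k
    · obtain ⟨ζ, hζ, h⟩ := (hXs k).exists_bound (L.lt_cof_ord_succ (hclt k).le) (a k)
        (fun ρ hρ => hA (ha k ρ hk (hXc k hρ)).1)
      exact ⟨ζ, hζ, fun _ => h⟩
    · exact ⟨α₀, hα₀, fun h => absurd h hk⟩
  choose y hy hy' using this
  obtain ⟨ζ, hζ, hζ'⟩ := huniv.exists_bound L.aleph0_lt_cof y (fun k _ => hy k)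
  refine ⟨max ζ α₀, max_lt hζ hα₀, fun β hβ hle n => ?_⟩
  obtain ⟨N, hN⟩ := eventually_atTop.1 (hd β hβ ((le_max_right _ _).trans hle))
  set k := Nat.pair n (max N k₀) with hk
  have hkN : max N k₀ ≤ k := Nat.right_le_pair _ _
  have hk0 : k₀ ≤ k := (le_max_right _ _).trans hkN
  obtain ⟨ρ, hρ, hgρ⟩ := hXu k _ (hgc β k)
  obtain ⟨h1, h2⟩ := ha k ρ hk0 (hXc k hρ)
  refine ⟨a k ρ, h1, lt_max_of_lt_left ((hy' k hk0 ρ hρ).trans (hζ' k trivial)), ?_⟩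
  have : sInf {j | ∀ i > j, g (a k ρ) i ≤ g β i} = k := by
    refine le_antisymm (Nat.sInf_le fun i hi => ?_) (le_csInf ⟨k, fun i hi => ?_⟩ fun j hj => ?_)
    · exact ((hz' i k hk0 hi ρ hρ).trans (hN i (by omega))).le
    · exact ((hz' i k hk0 hi ρ hρ).trans (hN i (by omega))).le
    · by_contra! hjk
      exact (hgρ.trans_lt h2).not_ge (hj k hjk)
  dsimp only
  rw [this, hk, Nat.unpair_pair]

theorem strictSup_mono {X Y : Set Ordinal.{u}} {z : Ordinal.{u}} (hY : ∀ y ∈ Y, y < z)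
    (h : X ⊆ Y) : strictSup X ≤ strictSup Y :=
  strictSup_le fun _ hx => lt_strictSup hY (h hx)

theorem SizeLE.strictSup_lt {X : Set Ordinal.{u}} {c : Cardinal.{u}} {o : Ordinal.{u}}
    (h : SizeLE X c) (hc : c < o.cof) (hX : X ⊆ Iio o) : strictSup X < o := by
  obtain ⟨b, hb, hXb⟩ := h.exists_bound hc id hX
  exact (strictSup_le hXb).trans_lt hb

/-- In a set `D` with no points between `η` and `b`, the next point from `α ∈ (η, b]` is `b`. -/
theorem nextIn_eq_of_strictSup_le {D : Set Ordinal.{u}} {η α b : Ordinal.{u}} (hb : b ∈ D)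
    (hη : strictSup (D ∩ Iio b) ≤ η) (hηα : η ≤ α) (hαb : α ≤ b) : nextIn D α = b := by
  refine (nextIn_le hb hαb).antisymm (le_of_not_gt fun h => ?_)
  obtain ⟨h1, h2⟩ := nextIn_spec ⟨b, hb, hαb⟩
  exact (lt_strictSup (fun _ hx => hx.2) (show _ ∈ D ∩ Iio b from ⟨h1, h⟩)).not_ge
    (hη.trans (hηα.trans h2))

theorem LadderSystem.exists_good {lam : Cardinal.{u}} (L : LadderSystem lam)
    {𝓔 : Set (Set Ordinal.{u})} (h𝓔 : 𝓔.Countable) {A B E : Set Ordinal.{u}}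
    (hA : IsCofinalIn A (Order.succ lam).ord) (hB : IsCofinalIn B (Order.succ lam).ord)
    {δ : Ordinal.{u}} (hδ : δ < (Order.succ lam).ord)
    (hδE : ∀ n, ∃ b ∈ L.reach 𝓔 δ n, b ∈ E ∧ L.μ n < b.cof) {θ : Cardinal.{u}} (hθ : θ < lam) :
    ∃ x ∈ E, ∃ n, ∃ η < x, θ < x.cof ∧
      (∀ p < (Order.succ lam).ord, ∃ α ∈ A, p ≤ α ∧ x ∈ L.reach 𝓔 α n ∧
        strictSup (L.reach 𝓔 α n ∩ Iio x) ≤ η) ∧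
      ∀ p < (Order.succ lam).ord, ∃ β ∈ B, p ≤ β ∧ x ∈ L.reach 𝓔 β n ∧
        strictSup (L.reach 𝓔 β n ∩ Iio x) = η := by
  set Λ := (Order.succ lam).ord with hΛ
  have huniv : SizeLE (univ : Set ℕ) ℵ₀ := SizeLE.of_countable (to_countable _) le_rfl
  have hD : ∀ γ < Λ, ∀ C, IsCofinalIn C Λ → ∃ m, ∀ p < Λ, ∃ α ∈ C, α < Λ ∧ p ≤ α ∧
      ∀ n ≥ m, γ ∈ L.reach 𝓔 α n := by
    intro γ hγ C hC
    have : ∀ α, ∃ m, γ < α → α < Λ → ∀ n ≥ m, γ ∈ L.reach 𝓔 α n := by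
      intro α
      by_cases h : γ < α ∧ α < Λ
      · obtain ⟨m, hm⟩ := L.mem_F α h.2 γ h.1
        exact ⟨m, fun _ _ n hn => mem_reach_of_mem_F (L.F_mono α h.2 hn hm)⟩
      · exact ⟨0, fun h1 h2 => absurd ⟨h1, h2⟩ h⟩
    choose m hm using this
    obtain ⟨k, -, hk⟩ := huniv.exists_fiber L.aleph0_lt_cof (X := {α | α ∈ C ∧ γ < α})
      (fun p hp => by
        obtain ⟨q, hq, hpq⟩ := hC.2 (max p (γ + 1)) (max_lt hp (L.add_one_lt hγ))
        exact ⟨q, ⟨hq, (lt_add_one γ).trans_le ((le_max_right _ _).trans hpq)⟩, hC.1 hq,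
          (le_max_left _ _).trans hpq⟩) m (fun _ _ _ => trivial)
    refine ⟨k, fun p hp => ?_⟩
    obtain ⟨q, hq, hqΛ, hpq, rfl⟩ := hk p hp
    exact ⟨q, hq.1, hqΛ, hpq, hm q hq.2 hqΛ⟩
  choose b hbD hbE hbcof using hδE
  have hbΛ : ∀ n, b n < Λ := fun n => (reach_le hδ (hbD n)).trans_lt hδ
  let u : Ordinal.{u} → ℕ → Ordinal.{u} := fun α n => strictSup (L.reach 𝓔 α n ∩ Iio (b n))
  have hub : ∀ α < Λ, ∀ n, u α n < b n := fun α hα n =>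
    ((reach_size h𝓔 hα).mono inter_subset_left).strictSup_lt (hbcof n) inter_subset_right
  obtain ⟨m, hm⟩ := hD δ hδ A hA
  let A' : Set Ordinal.{u} := {α | α ∈ A ∧ ∀ n ≥ m, δ ∈ L.reach 𝓔 α n}
  have : ∀ n, ∃ η < b n, (∀ p < Λ, ∃ α ∈ A', p ≤ α ∧ u α n ≤ η) ∧
      ∃ ζ < Λ, ∀ α ∈ A', ζ ≤ α → η ≤ u α n := by
    intro n
    obtain ⟨t, ht, htA⟩ := (SizeLE.Iio_ordinal (b n)).exists_fiber (L.card_lt_cof _ (hbΛ n))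
      (X := A') (fun p hp => by
        obtain ⟨α, h1, h2, h3, h4⟩ := hm p hp
        exact ⟨α, ⟨h1, h4⟩, h2, h3⟩) (fun α => u α n) (fun α _ hα => hub α hα n)
    have htS : t ∈ {η | ∀ p < Λ, ∃ α ∈ A', p ≤ α ∧ u α n ≤ η} := fun p hp => by
      obtain ⟨α, h1, -, h2, h3⟩ := htA p hp
      exact ⟨α, h1, h2, h3.le⟩
    set η := sInf {η | ∀ p < Λ, ∃ α ∈ A', p ≤ α ∧ u α n ≤ η} with hη
    have hηb : η < b n := (csInf_le' htS).trans_lt ht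
    refine ⟨η, hηb, csInf_mem ⟨t, htS⟩, ?_⟩
    have : ∀ y, ∃ p < Λ, y < η → ∀ α ∈ A', p ≤ α → y < u α n := by
      intro y
      by_cases hy : y < η
      · have h1 : ¬ ∀ p < Λ, ∃ α ∈ A', p ≤ α ∧ u α n ≤ y := fun h => notMem_of_lt_csInf' hy h
        push Not at h1
        obtain ⟨p, hp, h1⟩ := h1
        exact ⟨p, hp, fun _ => h1⟩
      · exact ⟨δ, hδ, fun h => absurd h hy⟩
    choose p hp hp' using this
    obtain ⟨ζ, hζ, hζ'⟩ := (SizeLE.Iio_ordinal η).exists_bound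
      (L.card_lt_cof _ (hηb.trans (hbΛ n))) p (fun y _ => hp y)
    refine ⟨ζ, hζ, fun α hα hζα => le_of_not_gt fun h => ?_⟩
    exact (hp' _ h α hα ((hζ' _ h).le.trans hζα)).false
  choose η hηb hηA z hz hηz using this
  obtain ⟨ζ, hζ, hζ'⟩ := huniv.exists_bound L.aleph0_lt_cof z (fun n _ => hz n)
  obtain ⟨γ, hγA, hγ, hζγ, hγδ⟩ := hm ζ hζ
  obtain ⟨m', hm'⟩ := hD γ hγ B hB
  obtain ⟨k, hk⟩ := L.exists_lt_μ θ hθ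
  set n := max k (max m m') with hn
  have hnm : m ≤ n := by omega
  have hnm' : m' ≤ n := by omega
  let B' : Set Ordinal.{u} := {β | β ∈ B ∧ ∀ n ≥ m', γ ∈ L.reach 𝓔 β n}
  obtain ⟨t, ht, htB⟩ := (SizeLE.Iio_ordinal (b n)).exists_fiber (L.card_lt_cof _ (hbΛ n))
    (X := B') (fun p hp => by
      obtain ⟨β, h1, h2, h3, h4⟩ := hm' p hp
      exact ⟨β, ⟨h1, h4⟩, h2, h3⟩) (fun β => u β n) (fun β _ hβ => hub β hβ n)
  have hηt : η n ≤ t := by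
    obtain ⟨β, hβ, -, -, rfl⟩ := htB δ hδ
    refine (hηz n γ ⟨hγA, hγδ⟩ ((hζ' n trivial).le.trans hζγ)).trans ?_
    exact strictSup_mono (fun _ hy => hy.2)
      (inter_subset_inter_left _ (reach_trans (hβ.2 n hnm')))
  refine ⟨b n, hbE n, n, t, ht, ?_, fun p hp => ?_, fun p hp => ?_⟩
  · exact (hk.trans_le (L.μ_strictMono.monotone (le_max_left _ _))).trans (hbcof n)
  · obtain ⟨α, hα, hpα, h⟩ := hηA n p hp
    exact ⟨α, hα.1, hpα, reach_trans (hα.2 n hnm) (hbD n), h.trans hηt⟩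
  · obtain ⟨β, hβ, -, hpβ, h⟩ := htB p hp
    exact ⟨β, hβ.1, hpβ,
      reach_trans (hβ.2 n hnm') (reach_trans (hγδ n hnm) (hbD n)), h⟩

theorem rectangles_into_squares_case (lam : Cardinal)
    (hcof : lam.ord.cof = Cardinal.aleph0) (hsing : Cardinal.aleph0 < lam) :
    ∃ rts : Ordinal → Ordinal → Ordinal × Ordinal,
      ∀ A B : Set Ordinal,
        IsCofinalIn A (Order.succ lam).ord → IsCofinalIn B (Order.succ lam).ord →
        ∀ θ : Cardinal, θ < lam →
          ∃ S : Set Ordinal, IsStationaryIn S (Order.succ lam).ord ∧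
            (∀ ε ∈ S, θ < Ordinal.cof ε) ∧
            ∀ a ∈ S, ∀ b ∈ S, a < b →
              ∃ α ∈ A, ∃ β ∈ B, α < β ∧ rts α β = (a, b) := by
  obtain ⟨L⟩ := exists_ladderSystem hcof hsing
  obtain ⟨𝓔, h𝓔, hguess⟩ := L.exists_guessing
  obtain ⟨Γ, hΓ⟩ := L.exists_coloring
  let D : Ordinal → ℕ → Set Ordinal := L.reach 𝓔
  refine ⟨fun α β => (nextIn (D α (Γ α β)) (strictSup (D β (Γ α β) ∩ Iio α)),
    nextIn (D β (Γ α β)) α), fun A B hA hB θ hθ => ?_⟩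
  let Q : ℕ → Ordinal → Ordinal → Prop := fun n η x => η < x ∧ θ < x.cof ∧
    (∀ p < (Order.succ lam).ord, ∃ α ∈ A, p ≤ α ∧ x ∈ D α n ∧ strictSup (D α n ∩ Iio x) ≤ η) ∧
    ∀ p < (Order.succ lam).ord, ∃ β ∈ B, p ≤ β ∧ x ∈ D β n ∧ strictSup (D β n ∩ Iio x) = η
  obtain ⟨n, η, hη, hS⟩ := exists_stationary_of_forall_club L.aleph0_lt_cof L.card_lt_cof Q
    (fun E hE => by
      obtain ⟨δ, hδ, h⟩ := hguess E hE
      obtain ⟨x, hx, n, η, hη, h⟩ := L.exists_good h𝓔 hA hB hδ h hθ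
      exact ⟨x, hx, n, η, hη, hη, h⟩)
  have : ∀ a, ∃ ζ < (Order.succ lam).ord, (∀ p < (Order.succ lam).ord, ∃ α ∈ A, p ≤ α ∧
      a ∈ D α n ∧ strictSup (D α n ∩ Iio a) ≤ η) → a < (Order.succ lam).ord →
      ∀ β < (Order.succ lam).ord, ζ ≤ β → ∃ α ∈ A, a ≤ α ∧ a ∈ D α n ∧
        strictSup (D α n ∩ Iio a) ≤ η ∧ α < ζ ∧ Γ α β = n := by
    intro a
    by_cases ha : (∀ p < (Order.succ lam).ord, ∃ α ∈ A, p ≤ α ∧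
      a ∈ D α n ∧ strictSup (D α n ∩ Iio a) ≤ η) ∧ a < (Order.succ lam).ord
    · obtain ⟨ζ, hζ, h⟩ := hΓ {α | α ∈ A ∧ a ≤ α ∧ a ∈ D α n ∧ strictSup (D α n ∩ Iio a) ≤ η}
        (fun α hα => hA.1 hα.1) (fun p hp => by
          obtain ⟨α, h1, h2, h3⟩ := ha.1 (max p a) (max_lt hp ha.2)
          exact ⟨α, ⟨h1, (le_max_right _ _).trans h2, h3⟩, (le_max_left _ _).trans h2⟩)
      refine ⟨ζ, hζ, fun _ _ β hβ hζβ => ?_⟩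
      obtain ⟨α, ⟨h1, h2, h3, h4⟩, h5, h6⟩ := h β hβ hζβ n
      exact ⟨α, h1, h2, h3, h4, h5, h6⟩
    · exact ⟨η, hη, fun h1 h2 => absurd ⟨h1, h2⟩ ha⟩
  choose ζ hζ hζ' using this
  have hclub := isClubIn_closurePoints_of_regular L.aleph0_lt_cof L.card_lt_cof ζ
    (fun q _ => hζ q)
  refine ⟨{x | x < (Order.succ lam).ord ∧ Q n η x} ∩
      {p | p < (Order.succ lam).ord ∧ p ≠ 0 ∧ ∀ q < p, ζ q < p},
    ⟨fun x hx => hS.1 hx.1, fun C hC => ?_⟩, fun x hx => hx.1.2.2.1, ?_⟩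
  · obtain ⟨x, hx, hxE⟩ := hS.2 _ (hclub.inter L.aleph0_lt_cof hC)
    exact ⟨x, ⟨hx, hxE.1⟩, hxE.2⟩
  rintro a ⟨⟨ha, hηa, -, haA, -⟩, -⟩ b ⟨⟨hb, -, -, -, hbB⟩, -, -, hbζ⟩ hab
  obtain ⟨β, hβ, hbβ, hbD, hbη⟩ := hbB b hb
  obtain ⟨α, hα, haα, haD, haη, hαζ, hαβ⟩ :=
    hζ' a haA ha β (hB.1 hβ) ((hbζ a hab).le.trans hbβ)
  have hαb : α < b := hαζ.trans (hbζ a hab)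
  refine ⟨α, hα, β, hβ, hαb.trans_le hbβ, ?_⟩
  have h1 : D β n ∩ Iio α = D β n ∩ Iio b := by
    refine Subset.antisymm (inter_subset_inter_right _ (Iio_subset_Iio hαb.le)) fun x hx => ?_
    exact ⟨hx.1, ((lt_strictSup (fun _ hy => hy.2) hx).trans_eq hbη).trans
      (hηa.trans_le haα)⟩
  dsimp only
  rw [hαβ, h1, hbη, nextIn_eq_of_strictSup_le haD haη le_rfl hηa.le,
    nextIn_eq_of_strictSup_le hbD hbη.le (hηa.le.trans haα) hαb.le]
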